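/- Let X be a Hilbert space and let {A(t) : t ≥ 0} be a family of linear operators with common domain D such that each A(t) generates a contraction C₀-semigroup on X (elementary Kato class) and A(·) : [0,∞) → L(D,X) is strongly C¹-differentiable (D carrying the graph norm). Then {A(t) : t ≥ 0} generates a backward evolution family on X. -/

import Mathlib

open Set Filter MeasureTheory
open scoped ComplexInnerProductSpace

noncomputable section

namespace NBCS

/-! ### Evolution families and non-autonomous Cauchy problems -/

section NormedDefs

variable {X U Y : Type*}
variable [NormedAddCommGroup X] [NormedSpace ℂ X]
variable [NormedAddCommGroup U] [NormedSpace ℂ U]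
variable [NormedAddCommGroup Y] [NormedSpace ℂ Y]

/-- An evolution family on `X`, indexed by `Δ = {(t,s) : 0 ≤ s ≤ t}`. -/
def IsEvolutionFamily (W : ℝ → ℝ → X →L[ℂ] X) : Prop :=
  (∀ t, 0 ≤ t → W t t = 1) ∧
  (∀ s r t : ℝ, 0 ≤ s → s ≤ r → r ≤ t → W t s = (W t r).comp (W r s)) ∧
  (∀ x : X, ContinuousOn (fun p : ℝ × ℝ => W p.1 p.2 x) {p : ℝ × ℝ | 0 ≤ p.2 ∧ p.2 ≤ p.1})

/-- A backward evolution family on `X`. -/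
def IsBackwardEvolutionFamily (V : ℝ → ℝ → X →L[ℂ] X) : Prop :=
  (∀ t, 0 ≤ t → V t t = 1) ∧
  (∀ s r t : ℝ, 0 ≤ s → s ≤ r → r ≤ t → V t s = (V r s).comp (V t r)) ∧
  (∀ x : X, ContinuousOn (fun p : ℝ × ℝ => V p.1 p.2 x) {p : ℝ × ℝ | 0 ≤ p.2 ∧ p.2 ≤ p.1})

/-- A classical solution (continuous on `[s,∞)`, `C¹` on `(s,∞)`) of the inhomogeneous
non-autonomous Cauchy problem `ẋ(t) = A(t)x(t) + F(t)` on `[s,∞)`, `x(s) = xs`, where the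
(in general unbounded) operator `A(t)` is encoded by a globally defined linear map together
with its domain `domA t`. -/
def IsClassicalSolution (A : ℝ → X →ₗ[ℂ] X) (domA : ℝ → Submodule ℂ X)
    (F : ℝ → X) (s : ℝ) (xs : X) (x : ℝ → X) : Prop :=
  ContinuousOn x (Ici s) ∧ x s = xs ∧ (∀ t, s ≤ t → x t ∈ domA t) ∧
  (∀ t, s < t → HasDerivAt x (A t (x t) + F t) t) ∧
  ContinuousOn (fun t => A t (x t) + F t) (Ioi s)

/-- A classical solution which is `C¹` up to the initial time `s`. -/
def IsClassicalSolutionC1 (A : ℝ → X →ₗ[ℂ] X) (domA : ℝ → Submodule ℂ X)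
    (F : ℝ → X) (s : ℝ) (xs : X) (x : ℝ → X) : Prop :=
  x s = xs ∧ (∀ t, s ≤ t → x t ∈ domA t) ∧
  (∀ t, s ≤ t → HasDerivWithinAt x (A t (x t) + F t) (Ici s) t) ∧
  ContinuousOn (fun t => A t (x t) + F t) (Ici s)

/-- The family `{A(t)}` generates the evolution family `W` with regularity spaces `Yreg`. -/
def Generates (A : ℝ → X →ₗ[ℂ] X) (domA : ℝ → Submodule ℂ X)
    (W : ℝ → ℝ → X →L[ℂ] X) (Yreg : ℝ → Submodule ℂ X) : Prop :=
  IsEvolutionFamily W ∧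
  (∀ t, 0 ≤ t → Dense (Yreg t : Set X)) ∧
  (∀ t, 0 ≤ t → Yreg t ≤ domA t) ∧
  (∀ s t : ℝ, 0 ≤ s → s ≤ t → ∀ x ∈ Yreg s, W t s x ∈ Yreg t) ∧
  (∀ s, 0 ≤ s → ∀ xs ∈ Yreg s,
    IsClassicalSolution A domA (fun _ => 0) s xs (fun t => W t s xs)) ∧
  (∀ s, 0 ≤ s → ∀ xs ∈ Yreg s, ∀ x, IsClassicalSolution A domA (fun _ => 0) s xs x →
    ∀ t, s ≤ t → x t = W t s xs)

/-- A classical solution of the backward problem `u'(s) = -A(s)u(s)` on `[0,t]`, `u(t) = xt`. -/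
def IsBackwardSolution (A : ℝ → X →ₗ[ℂ] X) (domA : ℝ → Submodule ℂ X)
    (t : ℝ) (xt : X) (u : ℝ → X) : Prop :=
  u t = xt ∧ (∀ s ∈ Icc (0:ℝ) t, u s ∈ domA s) ∧
  (∀ s ∈ Icc (0:ℝ) t, HasDerivWithinAt u (-(A s (u s))) (Icc (0:ℝ) t) s) ∧
  ContinuousOn (fun s => A s (u s)) (Icc (0:ℝ) t)

/-- The family `{A(t)}` generates the backward evolution family `V` with
regularity spaces `Yreg`. -/
def GeneratesBackward (A : ℝ → X →ₗ[ℂ] X) (domA : ℝ → Submodule ℂ X)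
    (V : ℝ → ℝ → X →L[ℂ] X) (Yreg : ℝ → Submodule ℂ X) : Prop :=
  IsBackwardEvolutionFamily V ∧
  (∀ t, 0 ≤ t → Dense (Yreg t : Set X)) ∧
  (∀ t, 0 ≤ t → Yreg t ≤ domA t) ∧
  (∀ s t : ℝ, 0 ≤ s → s ≤ t → ∀ x ∈ Yreg t, V t s x ∈ Yreg s) ∧
  (∀ t, 0 ≤ t → ∀ xt ∈ Yreg t, IsBackwardSolution A domA t xt (fun s => V t s xt)) ∧
  (∀ t, 0 ≤ t → ∀ xt ∈ Yreg t, ∀ u, IsBackwardSolution A domA t xt u →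
    ∀ s ∈ Icc (0:ℝ) t, u s = V t s xt)

/-! ### `C₀`-semigroups and Kato's classes -/

/-- `T` is a strongly continuous one-parameter semigroup on `X`. -/
def IsC0Semigroup (T : ℝ → X →L[ℂ] X) : Prop :=
  T 0 = 1 ∧ (∀ s t : ℝ, 0 ≤ s → 0 ≤ t → T (s + t) = (T s).comp (T t)) ∧
  ∀ x : X, ContinuousOn (fun t => T t x) (Ici (0:ℝ))

/-- `A` (with domain `domA`) is the generator of the `C₀`-semigroup `T`. -/
def IsGenerator (A : X →ₗ[ℂ] X) (domA : Submodule ℂ X) (T : ℝ → X →L[ℂ] X) : Prop :=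
  IsC0Semigroup T ∧
  (∀ x : X, x ∈ domA ↔
    ∃ y, Tendsto (fun h : ℝ => h⁻¹ • (T h x - x)) (nhdsWithin 0 (Ioi 0)) (nhds y)) ∧
  (∀ x ∈ domA, Tendsto (fun h : ℝ => h⁻¹ • (T h x - x)) (nhdsWithin 0 (Ioi 0)) (nhds (A x)))

/-- `A` generates a contraction `C₀`-semigroup on `X` (with respect to the given norm). -/
def GeneratesContractionSemigroup (A : X →ₗ[ℂ] X) (domA : Submodule ℂ X) : Prop :=
  ∃ T : ℝ → X →L[ℂ] X, IsGenerator A domA T ∧ ∀ t, 0 ≤ t → ‖T t‖ ≤ 1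

/-- `A` generates a `C₀`-semigroup on `X` which is contractive with respect to the
(equivalent) norm `N`. -/
def GeneratesContractionSemigroupWrt (N : X → ℝ) (A : X →ₗ[ℂ] X) (domA : Submodule ℂ X) :
    Prop :=
  ∃ T : ℝ → X →L[ℂ] X, IsGenerator A domA T ∧ ∀ t, 0 ≤ t → ∀ x : X, N (T t x) ≤ N x

/-- `N` is a norm on `X` which is equivalent to the original norm. -/
def IsEquivNorm (N : X → ℝ) : Prop :=
  (∀ x y : X, N (x + y) ≤ N x + N y) ∧ (∀ (c : ℂ) (x : X), N (c • x) = ‖c‖ * N x) ∧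
  (∀ x : X, N x = 0 ↔ x = 0) ∧
  ∃ m M : ℝ, 0 < m ∧ 0 < M ∧ ∀ x : X, m * ‖x‖ ≤ N x ∧ N x ≤ M * ‖x‖

/-- The family `{A(t)}` is Kato-stable. -/
def KatoStable (A : ℝ → X →ₗ[ℂ] X) (domA : ℝ → Submodule ℂ X) : Prop :=
  ∃ N : ℝ → X → ℝ,
    (∀ t, 0 ≤ t → IsEquivNorm (N t)) ∧
    (∀ T : ℝ, 0 ≤ T → ∃ c : ℝ, 0 ≤ c ∧ ∀ (x : X), ∀ s ∈ Icc (0:ℝ) T, ∀ t ∈ Icc (0:ℝ) T,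
      |N t x - N s x| ≤ c * |t - s| * N s x) ∧
    (∀ t, 0 ≤ t → GeneratesContractionSemigroupWrt (N t) (A t) (domA t))

/-- The family `{A(t)}` belongs to the elementary Kato class: every `A(t)` generates a
contraction `C₀`-semigroup on `X`. -/
def ElementaryKatoClass (A : ℝ → X →ₗ[ℂ] X) (domA : ℝ → Submodule ℂ X) : Prop :=
  ∀ t, 0 ≤ t → GeneratesContractionSemigroup (A t) (domA t)

/-- The family `{A(t)}` belongs to Kato's class: it is Kato-stable, the operators have the
common domain `D` and `A(·)` is strongly `C¹`. -/
def KatoClass (A : ℝ → X →ₗ[ℂ] X) (domA : ℝ → Submodule ℂ X) (D : Submodule ℂ X) : Prop :=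
  KatoStable A domA ∧ (∀ t, 0 ≤ t → domA t = D) ∧
  ∀ x ∈ D, ContDiffOn ℝ 1 (fun t => A t x) (Ici (0:ℝ))

/-! ### Boundary control and observation systems -/

/-- Compatibility of the operator `B̃ ∈ L(U,X)` with the boundary control system
`(𝔄, D(𝔄), 𝔅)`:  `B̃u ∈ D(𝔄)`, `𝔄B̃ ∈ L(U,X)` and `𝔅B̃u = u` for all `u ∈ U`. -/
def BtCompat (Af : X →ₗ[ℂ] X) (domA : Submodule ℂ X) (Bf : X →ₗ[ℂ] U)
    (Bt : U →L[ℂ] X) : Prop :=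
  (∀ v : U, Bt v ∈ domA) ∧ (∃ c : ℝ, ∀ v : U, ‖Af (Bt v)‖ ≤ c * ‖v‖) ∧
  ∀ v : U, Bf (Bt v) = v

/-- `Σ(𝔄,𝔅,𝔆)` is a boundary control and observation (BCO) system: the main operator
`A = 𝔄|_{D(𝔄) ∩ ker 𝔅}` generates a `C₀`-semigroup, there is a compatible `B̃ ∈ L(U,X)`,
and `𝔆` is bounded with respect to the graph norm of `𝔄`. -/
def IsBCO (Af : X →ₗ[ℂ] X) (domA : Submodule ℂ X) (Bf : X →ₗ[ℂ] U) (Cf : X →ₗ[ℂ] Y) :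
    Prop :=
  (∃ T : ℝ → X →L[ℂ] X, IsGenerator Af (domA ⊓ LinearMap.ker Bf) T) ∧
  (∃ Bt : U →L[ℂ] X, BtCompat Af domA Bf Bt) ∧
  (∃ c : ℝ, ∀ x ∈ domA, ‖Cf x‖ ≤ c * (‖x‖ + ‖Af x‖))

/-- A classical solution of the autonomous boundary control problem
`ẋ(t) = 𝔄x(t)`, `𝔅x(t) = u(t)`, `x(0) = x₀`. -/
def IsClassicalSolAut (Af : X →ₗ[ℂ] X) (domA : Submodule ℂ X) (Bf : X →ₗ[ℂ] U)
    (u : ℝ → U) (x₀ : X) (x : ℝ → X) : Prop :=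
  x 0 = x₀ ∧ (∀ t, (0:ℝ) ≤ t → x t ∈ domA) ∧
  (∀ t, (0:ℝ) ≤ t → HasDerivWithinAt x (Af (x t)) (Ici (0:ℝ)) t) ∧
  ContinuousOn (fun t => Af (x t)) (Ici (0:ℝ)) ∧
  ∀ t, (0:ℝ) ≤ t → Bf (x t) = u t

/-- A classical solution pair `(x,y)` of the autonomous BCO system. -/
def IsClassicalSolPairAut (Af : X →ₗ[ℂ] X) (domA : Submodule ℂ X) (Bf : X →ₗ[ℂ] U)
    (Cf : X →ₗ[ℂ] Y) (u : ℝ → U) (x₀ : X) (x : ℝ → X) (y : ℝ → Y) : Prop :=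
  IsClassicalSolAut Af domA Bf u x₀ x ∧ ContinuousOn y (Ici (0:ℝ)) ∧
  ∀ t, (0:ℝ) ≤ t → y t = Cf (x t)

/-- A classical solution of the non-autonomous boundary control problem
`ẋ(t) = 𝔄(t)x(t)`, `𝔅(t)x(t) = u(t)`, `x(s) = xs` on `[s,∞)`. -/
def IsClassicalSolN (Af : ℝ → X →ₗ[ℂ] X) (domA : ℝ → Submodule ℂ X)
    (Bf : ℝ → X →ₗ[ℂ] U) (u : ℝ → U) (s : ℝ) (xs : X) (x : ℝ → X) : Prop :=
  x s = xs ∧ (∀ t, s ≤ t → x t ∈ domA t) ∧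
  (∀ t, s ≤ t → HasDerivWithinAt x (Af t (x t)) (Ici s) t) ∧
  ContinuousOn (fun t => Af t (x t)) (Ici s) ∧
  ∀ t, s ≤ t → Bf t (x t) = u t

/-- A classical solution pair `(x,y)` of the non-autonomous BCO system. -/
def IsClassicalSolPairN (Af : ℝ → X →ₗ[ℂ] X) (domA : ℝ → Submodule ℂ X)
    (Bf : ℝ → X →ₗ[ℂ] U) (Cf : ℝ → X →ₗ[ℂ] Y)
    (u : ℝ → U) (s : ℝ) (xs : X) (x : ℝ → X) (y : ℝ → Y) : Prop :=
  IsClassicalSolN Af domA Bf u s xs x ∧ ContinuousOn y (Ici s) ∧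
  ∀ t, s ≤ t → y t = Cf t (x t)

/-- `Σ_N(𝔄,𝔅,𝔆)` is a non-autonomous boundary control and observation (NBCO) system:
each frozen-time system is a BCO system and the family of main operators generates the
evolution family `W` with regularity spaces `Yreg`. -/
def IsNBCO (Af : ℝ → X →ₗ[ℂ] X) (domA : ℝ → Submodule ℂ X) (Bf : ℝ → X →ₗ[ℂ] U)
    (Cf : ℝ → X →ₗ[ℂ] Y) (W : ℝ → ℝ → X →L[ℂ] X) (Yreg : ℝ → Submodule ℂ X) : Prop :=
  (∀ t, 0 ≤ t → IsBCO (Af t) (domA t) (Bf t) (Cf t)) ∧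
  Generates Af (fun t => domA t ⊓ LinearMap.ker (Bf t)) W Yreg

/-- Well-posedness of the non-autonomous BCO system. -/
def WellPosedN (Af : ℝ → X →ₗ[ℂ] X) (domA : ℝ → Submodule ℂ X) (Bf : ℝ → X →ₗ[ℂ] U)
    (Cf : ℝ → X →ₗ[ℂ] Y) : Prop :=
  ∀ τ : ℝ, 0 < τ → ∃ m : ℝ, 0 < m ∧ ∀ s, 0 ≤ s → s ≤ τ →
    ∀ (u : ℝ → U) (xs : X) (x : ℝ → X) (y : ℝ → Y),
      IsClassicalSolPairN Af domA Bf Cf u s xs x y →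
      ‖x τ‖ ^ 2 + ∫ r in s..τ, ‖y r‖ ^ 2 ≤ m * (‖xs‖ ^ 2 + ∫ r in s..τ, ‖u r‖ ^ 2)

/-- `u ∈ L²_loc([0,∞); V)`. -/
def L2loc {V : Type*} [NormedAddCommGroup V] (u : ℝ → V) : Prop :=
  ∀ T : ℝ, 0 < T →
    AEStronglyMeasurable u (volume.restrict (Icc (0:ℝ) T)) ∧
    IntegrableOn (fun r => ‖u r‖ ^ 2) (Icc (0:ℝ) T)

end NormedDefs

/-! ### Hilbert space notions -/

section HilbertDefs

variable {X U Y V : Type*}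
variable [NormedAddCommGroup X] [InnerProductSpace ℂ X]
variable [NormedAddCommGroup U] [InnerProductSpace ℂ U]
variable [NormedAddCommGroup Y] [InnerProductSpace ℂ Y]
variable [NormedAddCommGroup V] [InnerProductSpace ℂ V]

/-- A family of bounded operators each of which is self-adjoint. -/
def SelfAdjointFamily (M : ℝ → V →L[ℂ] V) : Prop :=
  ∀ t, 0 ≤ t → ∀ x y : V, ⟪M t x, y⟫ = ⟪x, M t y⟫

/-- A uniformly coercive family of bounded operators. -/
def UniformlyCoercive (M : ℝ → V →L[ℂ] V) : Prop :=
  ∃ β : ℝ, 0 < β ∧ ∀ t, 0 ≤ t → ∀ x : V, β * ‖x‖ ^ 2 ≤ (⟪M t x, x⟫).re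

/-- `B` (with domain `domB`) is the adjoint of the (densely defined) operator `A`
(with domain `domA`). -/
def IsAdjointOp (A : X →ₗ[ℂ] X) (domA : Submodule ℂ X) (B : X →ₗ[ℂ] X)
    (domB : Submodule ℂ X) : Prop :=
  (∀ y ∈ domB, ∀ x ∈ domA, ⟪B y, x⟫ = ⟪y, A x⟫) ∧
  (∀ y z : X, (∀ x ∈ domA, ⟪z, x⟫ = ⟪y, A x⟫) → y ∈ domB ∧ z = B y)

/-- The autonomous BCO system `Σ(𝔄,𝔅,𝔆)` is `(P,R,J)`-scattering passive. -/
def ScatteringPassive (Af : X →ₗ[ℂ] X) (domA : Submodule ℂ X) (Bf : X →ₗ[ℂ] U)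
    (Cf : X →ₗ[ℂ] Y) (P : X →L[ℂ] X) (R : U →L[ℂ] U) (J : Y →L[ℂ] Y) : Prop :=
  ∀ (u : ℝ → U) (x₀ : X) (x : ℝ → X) (y : ℝ → Y),
    IsClassicalSolPairAut Af domA Bf Cf u x₀ x y →
    ∀ t, (0:ℝ) ≤ t → ∀ d : ℝ,
      HasDerivWithinAt (fun τ => (⟪P (x τ), x τ⟫).re) d (Ici (0:ℝ)) t →
      d ≤ (⟪R (u t), u t⟫).re - (⟪y t, J (y t)⟫).re

/-- The autonomous BCO system `Σ(𝔄,𝔅,𝔆)` is `(P,R,J)`-scattering energy preserving. -/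
def ScatteringEnergyPreserving (Af : X →ₗ[ℂ] X) (domA : Submodule ℂ X) (Bf : X →ₗ[ℂ] U)
    (Cf : X →ₗ[ℂ] Y) (P : X →L[ℂ] X) (R : U →L[ℂ] U) (J : Y →L[ℂ] Y) : Prop :=
  ∀ (u : ℝ → U) (x₀ : X) (x : ℝ → X) (y : ℝ → Y),
    IsClassicalSolPairAut Af domA Bf Cf u x₀ x y →
    ∀ t, (0:ℝ) ≤ t → ∀ d : ℝ,
      HasDerivWithinAt (fun τ => (⟪P (x τ), x τ⟫).re) d (Ici (0:ℝ)) t →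
      d = (⟪R (u t), u t⟫).re - (⟪y t, J (y t)⟫).re

/-- The non-autonomous BCO system `Σ_N(𝔄,𝔅,𝔆)` is `(R,P,J)`-scattering passive;
here `P'` is the strong derivative of `P`. -/
def NScatteringPassive (Af : ℝ → X →ₗ[ℂ] X) (domA : ℝ → Submodule ℂ X)
    (Bf : ℝ → X →ₗ[ℂ] U) (Cf : ℝ → X →ₗ[ℂ] Y)
    (R : ℝ → U →L[ℂ] U) (P P' : ℝ → X →L[ℂ] X) (J : ℝ → Y →L[ℂ] Y) : Prop :=
  ∀ s, (0:ℝ) ≤ s → ∀ (u : ℝ → U) (xs : X) (x : ℝ → X) (y : ℝ → Y),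
    IsClassicalSolPairN Af domA Bf Cf u s xs x y →
    ∀ t, s ≤ t → ∀ d : ℝ,
      HasDerivWithinAt (fun τ => (⟪P τ (x τ), x τ⟫).re) d (Ici s) t →
      d + (⟪y t, J t (y t)⟫).re ≤ (⟪u t, R t (u t)⟫).re + (⟪P' t (x t), x t⟫).re

/-- The pointwise characterization of `(R,P,J)`-scattering passivity of the non-autonomous
BCO system on the admissible spaces `𝒱(t)`. -/
def NScatteringPassivePointwise (Af : ℝ → X →ₗ[ℂ] X) (domA : ℝ → Submodule ℂ X)
    (Bf : ℝ → X →ₗ[ℂ] U) (Cf : ℝ → X →ₗ[ℂ] Y)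
    (R : ℝ → U →L[ℂ] U) (P : ℝ → X →L[ℂ] X) (J : ℝ → Y →L[ℂ] Y) : Prop :=
  ∀ t, (0:ℝ) ≤ t → ∀ (x : X) (u : U), x ∈ domA t → Bf t x = u →
    2 * (⟪Af t x, P t x⟫).re ≤ (⟪R t u, Bf t x⟫).re - (⟪Cf t x, J t (Cf t x)⟫).re

end HilbertDefs

end NBCS


namespace KatoBw

section Real
variable {H : Type*} [NormedAddCommGroup H] [InnerProductSpace ℝ H]

lemma hasDerivWithinAt_Ici_of_Icc {E : Type*} [NormedAddCommGroup E] [NormedSpace ℝ E]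
    {T : ℝ} {e : ℝ → E} {e' : E} {τ : ℝ} (hτ : τ ∈ Ico (0:ℝ) T)
    (h : HasDerivWithinAt e e' (Icc 0 T) τ) : HasDerivWithinAt e e' (Ici τ) τ := by
  apply h.mono_of_mem_nhdsWithin
  have : Icc τ T ∈ nhdsWithin τ (Ici τ) := Icc_mem_nhdsGE hτ.2
  exact mem_of_superset this (Icc_subset_Icc_left hτ.1)

/-- Energy estimate, integral form. -/
lemma energy_integral {T : ℝ} {e e' : ℝ → H} {φ : ℝ → ℝ} (hφ : Continuous φ)
    (he : ∀ τ ∈ Icc (0:ℝ) T, HasDerivWithinAt e (e' τ) (Icc 0 T) τ)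
    (h0 : ∀ τ ∈ Icc (0:ℝ) T, 0 ≤ φ τ)
    (h : ∀ τ ∈ Icc (0:ℝ) T, inner ℝ (e τ) (e' τ) ≤ ‖e τ‖ * φ τ) :
    ∀ τ ∈ Icc (0:ℝ) T, ‖e τ‖ ≤ ‖e 0‖ + ∫ r in (0:ℝ)..τ, φ r := by
  intro τ hτ
  refine le_of_forall_pos_le_add fun ε hε => ?_
  have hpos : ∀ σ, 0 < ‖e σ‖ ^ 2 + ε ^ 2 := fun σ => by positivity
  have hd : ∀ σ ∈ Icc (0:ℝ) T, HasDerivWithinAt (fun σ => √(‖e σ‖ ^ 2 + ε ^ 2))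
      ((2 * inner ℝ (e σ) (e' σ)) / (2 * √(‖e σ‖ ^ 2 + ε ^ 2))) (Icc 0 T) σ := by
    intro σ hσ
    exact (((he σ hσ).norm_sq).add_const (ε ^ 2)).sqrt (hpos σ).ne'
  have hB : ∀ σ, HasDerivAt (fun σ => ‖e 0‖ + ε + ∫ r in (0:ℝ)..σ, φ r) (φ σ) σ := fun σ =>
    (hφ.integral_hasStrictDerivAt 0 σ).hasDerivAt.const_add _
  have key := image_le_of_deriv_right_le_deriv_boundary (a := 0) (b := T)
    (f := fun σ => √(‖e σ‖ ^ 2 + ε ^ 2))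
    (f' := fun σ => (2 * inner ℝ (e σ) (e' σ)) / (2 * √(‖e σ‖ ^ 2 + ε ^ 2)))
    (B := fun σ => ‖e 0‖ + ε + ∫ r in (0:ℝ)..σ, φ r) (B' := φ)
    (fun σ hσ => (hd σ hσ).continuousWithinAt)
    (fun σ hσ => hasDerivWithinAt_Ici_of_Icc hσ (hd σ (Ico_subset_Icc_self hσ)))
    (by
      simp only [intervalIntegral.integral_same, add_zero]
      rw [Real.sqrt_le_left (by positivity)]
      nlinarith [norm_nonneg (e 0)])
    (fun σ _ => (hB σ).continuousAt.continuousWithinAt)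
    (fun σ _ => (hB σ).hasDerivWithinAt)
    (fun σ hσ => by
      have hσ' := Ico_subset_Icc_self hσ
      have hs : 0 < √(‖e σ‖ ^ 2 + ε ^ 2) := Real.sqrt_pos.2 (hpos σ)
      rw [div_le_iff₀ (by positivity)]
      have h1 : ‖e σ‖ ≤ √(‖e σ‖ ^ 2 + ε ^ 2) := Real.le_sqrt_of_sq_le (by nlinarith)
      have := h σ hσ'
      have := mul_le_mul_of_nonneg_right h1 (h0 σ hσ')
      linarith)
  have h2 := key hτ
  have h1 : ‖e τ‖ ≤ √(‖e τ‖ ^ 2 + ε ^ 2) := Real.le_sqrt_of_sq_le (by nlinarith)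
  linarith

/-- Energy estimate, Gronwall form. -/
lemma energy_gronwall {T : ℝ} {e e' : ℝ → H} {K ε : ℝ}
    (he : ∀ τ ∈ Icc (0:ℝ) T, HasDerivWithinAt e (e' τ) (Icc 0 T) τ)
    (h : ∀ τ ∈ Icc (0:ℝ) T, 2 * inner ℝ (e τ) (e' τ) ≤ K * ‖e τ‖ ^ 2 + ε) :
    ∀ τ ∈ Icc (0:ℝ) T, ‖e τ‖ ^ 2 ≤ gronwallBound (‖e 0‖ ^ 2) K ε τ := by
  intro τ hτ
  have hd := fun σ hσ => (he σ hσ).norm_sq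
  have := le_gronwallBound_of_liminf_deriv_right_le (a := 0) (b := T) (f := fun σ => ‖e σ‖ ^ 2)
    (f' := fun σ => 2 * inner ℝ (e σ) (e' σ)) (K := K) (ε := ε) (δ := ‖e 0‖ ^ 2)
    (fun σ hσ => (hd σ hσ).continuousWithinAt)
    (fun σ hσ r hr => by
      have := (hasDerivWithinAt_Ici_of_Icc hσ
        (hd σ (Ico_subset_Icc_self hσ))).liminf_right_slope_le hr
      simpa [slope_def_field, div_eq_inv_mul] using this)
    le_rfl (fun σ hσ => h σ (Ico_subset_Icc_self hσ)) τ hτ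
  simpa using this

end Real

section Banach
variable {E : Type*} [NormedAddCommGroup E] [NormedSpace ℝ E]

/-- A Volterra type map has a fixed point. -/
lemma volterra [CompleteSpace E] {T : ℝ} (hT : 0 ≤ T)
    (Φ : C(Icc (0:ℝ) T, E) → C(Icc (0:ℝ) T, E)) {c : ℝ} (hc : 0 ≤ c)
    (h : ∀ f g (τ : Icc (0:ℝ) T), ‖Φ f τ - Φ g τ‖ ≤
      c * ∫ r in (0:ℝ)..τ, ‖IccExtend hT f r - IccExtend hT g r‖) :
    ∃ f, Φ f = f := by
  have key : ∀ (n : ℕ) f g (τ : Icc (0:ℝ) T),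
      ‖Φ^[n] f τ - Φ^[n] g τ‖ ≤ (c * τ) ^ n / n.factorial * ‖f - g‖ := by
    intro n
    induction n with
    | zero => intro f g τ; simpa using (f - g).norm_coe_le_norm τ
    | succ n ih =>
      intro f g τ
      rw [Function.iterate_succ_apply', Function.iterate_succ_apply']
      refine (h _ _ τ).trans ?_
      have hcont : ∀ u : C(Icc (0:ℝ) T, E), Continuous (IccExtend hT u) := fun u =>
        u.continuous.Icc_extend'
      have h1 : ∫ r in (0:ℝ)..τ, ‖IccExtend hT (Φ^[n] f) r - IccExtend hT (Φ^[n] g) r‖ ≤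
          ∫ r in (0:ℝ)..τ, (c * r) ^ n / n.factorial * ‖f - g‖ := by
        apply intervalIntegral.integral_mono_on τ.2.1
        · exact (((hcont _).sub (hcont _)).norm).intervalIntegrable _ _
        · exact Continuous.intervalIntegrable (by fun_prop) _ _
        · intro r hr
          have hr' : r ∈ Icc (0:ℝ) T := ⟨hr.1, hr.2.trans τ.2.2⟩
          rw [IccExtend_of_mem hT _ hr', IccExtend_of_mem hT _ hr']
          exact ih f g ⟨r, hr'⟩
      refine (mul_le_mul_of_nonneg_left h1 hc).trans (le_of_eq ?_)
      have h2 : ∫ r in (0:ℝ)..τ, (c * r) ^ n / n.factorial * ‖f - g‖ =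
          c ^ n / n.factorial * ‖f - g‖ * ∫ r in (0:ℝ)..τ, r ^ n := by
        rw [← intervalIntegral.integral_const_mul]
        congr 1; ext r; rw [mul_pow]; ring
      rw [h2, integral_pow, Nat.factorial_succ]
      push_cast
      field_simp
      ring
  obtain ⟨n, hn⟩ : ∃ n : ℕ, (c * T) ^ n / n.factorial < 1 / 2 :=
    ((FloorSemiring.tendsto_pow_div_factorial_atTop (c * T)).eventually_lt_const
      (by norm_num)).exists
  have hcw : ContractingWith (1 / 2 : NNReal) Φ^[n] := by
    refine ⟨by rw [← NNReal.coe_lt_coe]; norm_num, LipschitzWith.of_dist_le_mul fun f g => ?_⟩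
    rw [ContinuousMap.dist_le (by positivity)]
    intro τ
    rw [dist_eq_norm, dist_eq_norm]
    refine (key n f g τ).trans (mul_le_mul_of_nonneg_right ?_ (norm_nonneg _))
    have : (c * τ) ^ n / n.factorial ≤ (c * T) ^ n / n.factorial := by
      have h0 := τ.2.1
      have h2 := τ.2.2
      gcongr
    simp only [NNReal.coe_div, NNReal.coe_one, NNReal.coe_ofNat]
    linarith
  exact ⟨_, hcw.isFixedPt_fixedPoint_iterate⟩

/-- Joint continuity of strongly continuous bounded families. -/
lemma tendsto_apply {ι : Type*} {l : Filter ι} {M : ι → E →L[ℝ] E} {w : ι → E} {x y : E} {K : ℝ}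
    (hM : ∀ᶠ i in l, ‖M i‖ ≤ K) (hx : Tendsto (fun i => M i x) l (nhds y))
    (hw : Tendsto w l (nhds x)) : Tendsto (fun i => M i (w i)) l (nhds y) := by
  have h1 : Tendsto (fun i => M i (w i - x)) l (nhds 0) := by
    have h2 : Tendsto (fun i => K * ‖w i - x‖) l (nhds 0) := by
      have := (tendsto_iff_norm_sub_tendsto_zero.1 hw).const_mul K
      simpa using this
    refine squeeze_zero_norm' ?_ h2
    filter_upwards [hM] with i hi
    exact (M i).le_of_opNorm_le hi _
  have := h1.add hx
  simpa using this

lemma continuous_apply_of_bdd {M : ℝ → E →L[ℝ] E} {w : ℝ → E} {K : ℝ}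
    (hM : ∀ τ, ‖M τ‖ ≤ K) (hMc : ∀ x, Continuous fun τ => M τ x) (hw : Continuous w) :
    Continuous fun τ => M τ (w τ) := by
  rw [continuous_iff_continuousAt]
  intro τ
  exact tendsto_apply (Eventually.of_forall hM) ((hMc (w τ)).tendsto τ) (hw.tendsto τ)

/-- Existence for linear equations with bounded strongly continuous coefficients. -/
lemma linear_ode [CompleteSpace E] {T : ℝ} (hT : 0 ≤ T) {M : ℝ → E →L[ℝ] E} {K : ℝ}
    (hM : ∀ τ, ‖M τ‖ ≤ K) (hMc : ∀ x, Continuous fun τ => M τ x) {f : ℝ → E}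
    (hf : Continuous f) (y : E) :
    ∃ w : ℝ → E, Continuous w ∧ w 0 = y ∧
      ∀ τ ∈ Icc (0:ℝ) T, HasDerivWithinAt w (M τ (w τ) + f τ) (Icc 0 T) τ := by
  have hK : 0 ≤ K := (norm_nonneg _).trans (hM 0)
  have hcont : ∀ u : C(Icc (0:ℝ) T, E), Continuous (IccExtend hT u) := fun u =>
    u.continuous.Icc_extend'
  have hcF : ∀ u : C(Icc (0:ℝ) T, E), Continuous (fun r => M r (IccExtend hT u r) + f r) :=
    fun u => (continuous_apply_of_bdd hM hMc (hcont u)).add hf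
  have hD : ∀ (u : C(Icc (0:ℝ) T, E)) τ, HasDerivAt
      (fun τ => y + ∫ r in (0:ℝ)..τ, (M r (IccExtend hT u r) + f r))
      (M τ (IccExtend hT u τ) + f τ) τ := fun u τ =>
    ((hcF u).integral_hasStrictDerivAt 0 τ).hasDerivAt.const_add _
  have hC : ∀ (u : C(Icc (0:ℝ) T, E)), Continuous
      (fun τ => y + ∫ r in (0:ℝ)..τ, (M r (IccExtend hT u r) + f r)) := fun u =>
    continuous_iff_continuousAt.2 fun τ => (hD u τ).continuousAt
  let Φ : C(Icc (0:ℝ) T, E) → C(Icc (0:ℝ) T, E) := fun u =>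
    ⟨fun τ => y + ∫ r in (0:ℝ)..τ, (M r (IccExtend hT u r) + f r),
      (hC u).comp continuous_subtype_val⟩
  obtain ⟨v, hv⟩ := volterra hT Φ hK (by
    intro u g τ
    have : Φ u τ - Φ g τ = ∫ r in (0:ℝ)..τ, M r (IccExtend hT u r - IccExtend hT g r) := by
      simp only [Φ, ContinuousMap.coe_mk]
      rw [add_sub_add_left_eq_sub, ← intervalIntegral.integral_sub
        ((hcF u).intervalIntegrable _ _) ((hcF g).intervalIntegrable _ _)]
      congr 1; ext r; simp
    rw [this, ← intervalIntegral.integral_const_mul]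
    refine (intervalIntegral.norm_integral_le_integral_norm τ.2.1).trans ?_
    apply intervalIntegral.integral_mono_on τ.2.1
    · exact (continuous_apply_of_bdd hM hMc ((hcont u).sub (hcont g))).norm.intervalIntegrable _ _
    · exact (((hcont u).sub (hcont g)).norm.const_mul K).intervalIntegrable _ _
    · intro r _
      exact (M r).le_of_opNorm_le (hM r) _)
  refine ⟨_, hC v, by simp, fun τ hτ => ?_⟩
  have := (hD v τ).hasDerivWithinAt (s := Icc 0 T)
  have h2 : IccExtend hT v τ = y + ∫ r in (0:ℝ)..τ, (M r (IccExtend hT v r) + f r) := by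
    rw [IccExtend_of_mem hT _ hτ]
    exact (DFunLike.congr_fun hv ⟨τ, hτ⟩).symm
  rw [h2] at this
  exact this

end Banach
end KatoBw


namespace KatoBw

/-- Bounded data encoding a family of m-dissipative operators with common domain:
`J n τ = (1 - A(τ)/(n+1))⁻¹` and `C τ = minus the derivative of A times (1 - A(τ))⁻¹`. -/
structure KatoData (H : Type*) [NormedAddCommGroup H] [InnerProductSpace ℝ H] (T : ℝ) where
  J : ℕ → ℝ → H →L[ℝ] H
  C : ℝ → H →L[ℝ] H
  c : ℝ
  hT : 0 ≤ T
  Jn : ∀ n τ, ‖J n τ‖ ≤ 1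
  Jc : ∀ n x, Continuous fun τ => J n τ x
  Jlim : ∀ τ x, Tendsto (fun n => J n τ x) atTop (nhds x)
  Cn : ∀ τ, ‖C τ‖ ≤ c
  Cc : ∀ x, Continuous fun τ => C τ x
  res : ∀ (n : ℕ) τ x, J 0 τ (((n:ℝ) + 1) • x - (n:ℝ) • J n τ x) = J n τ x
  comm : ∀ n τ x, J 0 τ (J n τ x) = J n τ (J 0 τ x)
  diss : ∀ (n m : ℕ) τ x y,
    inner ℝ (((n:ℝ) + 1) • (J n τ x - x) - ((m:ℝ) + 1) • (J m τ y - y)) (J n τ x - J m τ y) ≤ 0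
  Rder : ∀ x, ∀ τ ∈ Icc (0:ℝ) T,
    HasDerivWithinAt (fun σ => J 0 σ x) (-(J 0 τ (C τ x))) (Icc 0 T) τ

namespace KatoData
variable {H : Type*} [NormedAddCommGroup H] [InnerProductSpace ℝ H] {T : ℝ} (d : KatoData H T)

/-- Yosida approximation. -/
def Y (n : ℕ) (τ : ℝ) : H →L[ℝ] H := ((n:ℝ) + 1) • (d.J n τ - 1)

lemma Y_apply (n : ℕ) (τ : ℝ) (x : H) : d.Y n τ x = ((n:ℝ) + 1) • (d.J n τ x - x) := by
  simp [Y]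

lemma Jle (n τ x) : ‖d.J n τ x‖ ≤ ‖x‖ := by simpa using (d.J n τ).le_of_opNorm_le (d.Jn n τ) x

lemma Cle (τ x) : ‖d.C τ x‖ ≤ d.c * ‖x‖ := (d.C τ).le_of_opNorm_le (d.Cn τ) x

lemma c0 : 0 ≤ d.c := (norm_nonneg _).trans (d.Cn 0)

lemma Y_norm (n τ) : ‖d.Y n τ‖ ≤ ((n:ℝ) + 1) * 2 := by
  refine ContinuousLinearMap.opNorm_le_bound _ (by positivity) fun x => ?_
  rw [Y_apply, norm_smul, Real.norm_of_nonneg (by positivity), mul_assoc]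
  have := d.Jle n τ x
  have h2 := norm_sub_le (d.J n τ x) x
  gcongr
  linarith

lemma Y_cont (n x) : Continuous fun τ => d.Y n τ x := by
  simp only [Y_apply]
  exact ((d.Jc n x).sub continuous_const).const_smul _

lemma diss1 (n τ x) : inner ℝ x (d.Y n τ x) ≤ 0 := by
  rw [Y_apply, inner_smul_right, inner_sub_right, real_inner_self_eq_norm_sq]
  have h1 := real_inner_le_norm x (d.J n τ x)
  have h2 := d.Jle n τ x
  have h3 : inner ℝ x (d.J n τ x) - ‖x‖ ^ 2 ≤ 0 := by nlinarith [norm_nonneg x]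
  exact mul_nonpos_of_nonneg_of_nonpos (by positivity) h3

lemma YR (n τ x) : d.Y n τ (d.J 0 τ x) = d.J n τ (d.J 0 τ x - x) := by
  have h := d.res n τ x
  rw [map_sub, map_smul, map_smul, d.comm] at h
  rw [Y_apply, map_sub]
  have h' : ((n:ℝ) + 1) • d.J 0 τ x = d.J n τ x + (n:ℝ) • d.J n τ (d.J 0 τ x) := by
    rw [← sub_eq_iff_eq_add, h]
  rw [smul_sub, h', add_smul, one_smul]
  abel

lemma RY (n τ x) : d.J 0 τ (d.Y n τ x) = d.Y n τ (d.J 0 τ x) := by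
  simp only [Y_apply, map_smul, map_sub, d.comm]

lemma Rprod {p : ℝ → H} {p' : H} {τ : ℝ} (hτ : τ ∈ Icc (0:ℝ) T)
    (hp : HasDerivWithinAt p p' (Icc 0 T) τ) :
    HasDerivWithinAt (fun σ => d.J 0 σ (p σ)) (d.J 0 τ p' - d.J 0 τ (d.C τ (p τ))) (Icc 0 T) τ := by
  have h1 := d.Rder (p τ) τ hτ
  rw [hasDerivWithinAt_iff_tendsto_slope] at *
  have h2 : Tendsto (fun σ => d.J 0 σ (slope p τ σ)) (nhdsWithin τ (Icc 0 T \ {τ}))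
      (nhds (d.J 0 τ p')) :=
    tendsto_apply (Eventually.of_forall fun σ => d.Jn 0 σ)
      (((d.Jc 0 p').tendsto τ).mono_left nhdsWithin_le_nhds) hp
  have h3 := h2.add h1
  rw [← sub_eq_add_neg] at h3
  refine h3.congr fun σ => ?_
  simp only [slope_def_module, map_smul, map_sub, ← smul_add]
  congr 1
  abel

/-- Solutions of the approximate equation. -/
def IsSol (n : ℕ) (f : ℝ → H) (x : H) (w : ℝ → H) : Prop :=
  Continuous w ∧ w 0 = x ∧
    ∀ τ ∈ Icc (0:ℝ) T, HasDerivWithinAt w (d.Y n τ (w τ) + f τ) (Icc 0 T) τ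

lemma exists_sol [CompleteSpace H] (n : ℕ) {f : ℝ → H} (hf : Continuous f) (x : H) :
    ∃ w, d.IsSol n f x w :=
  linear_ode d.hT (d.Y_norm n) (d.Y_cont n) hf x

/-- Stability. -/
lemma stab {n : ℕ} {f g : ℝ → H} {x y : H} {w z : ℝ → H} (hf : Continuous f) (hg : Continuous g)
    (hw : d.IsSol n f x w) (hz : d.IsSol n g y z) :
    ∀ τ ∈ Icc (0:ℝ) T, ‖w τ - z τ‖ ≤ ‖x - y‖ + ∫ r in (0:ℝ)..τ, ‖f r - g r‖ := by
  intro τ hτ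
  have := energy_integral (e := fun τ => w τ - z τ) (φ := fun r => ‖f r - g r‖) (T := T)
    ((hf.sub hg).norm) (fun τ hτ => (hw.2.2 τ hτ).sub (hz.2.2 τ hτ))
    (fun τ _ => norm_nonneg _) (fun τ _ => ?_) τ hτ
  · simpa [hw.2.1, hz.2.1] using this
  · have h1 : d.Y n τ (w τ) + f τ - (d.Y n τ (z τ) + g τ) = d.Y n τ (w τ - z τ) + (f τ - g τ) := by
      rw [map_sub]; abel
    rw [h1, inner_add_right]
    have := d.diss1 n τ (w τ - z τ)
    have := real_inner_le_norm (w τ - z τ) (f τ - g τ)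
    linarith

lemma stab' {n : ℕ} {f g : ℝ → H} {x y : H} {w z : ℝ → H} (hf : Continuous f) (hg : Continuous g)
    (hw : d.IsSol n f x w) (hz : d.IsSol n g y z) :
    ∀ τ ∈ Icc (0:ℝ) T, ‖w τ - z τ‖ ≤ ‖x - y‖ + ∫ r in (0:ℝ)..T, ‖f r - g r‖ := by
  intro τ hτ
  refine (d.stab hf hg hw hz τ hτ).trans ?_
  gcongr
  apply intervalIntegral.integral_mono_interval le_rfl hτ.1 hτ.2
  · exact Eventually.of_forall fun r => norm_nonneg _
  · exact (hf.sub hg).norm.intervalIntegrable _ _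

/-- Regular data: the Yosida solutions are uniformly Cauchy. -/
lemma regular [CompleteSpace H] {g : ℝ → H} (hg : Continuous g) (z : H) :
    ∃ (y : ℕ → ℝ → H) (M : ℝ), 0 ≤ M ∧
      (∀ n, d.IsSol n (fun τ => d.J 0 τ (g τ)) (d.J 0 0 z) (y n)) ∧
      ∀ n m : ℕ, ∀ τ ∈ Icc (0:ℝ) T,
        ‖y n τ - y m τ‖ ^ 2 ≤ M * (1 / ((n:ℝ) + 1) + 1 / ((m:ℝ) + 1)) := by
  have hp : ∀ n : ℕ, ∃ p : ℝ → H, Continuous p ∧ p 0 = z ∧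
      ∀ τ ∈ Icc (0:ℝ) T, HasDerivWithinAt p ((d.Y n τ + d.C τ) (p τ) + g τ) (Icc 0 T) τ := fun n =>
    linear_ode d.hT (M := fun τ => d.Y n τ + d.C τ) (K := ((n:ℝ) + 1) * 2 + d.c)
      (fun τ => (norm_add_le _ _).trans (add_le_add (d.Y_norm n τ) (d.Cn τ)))
      (fun x => (d.Y_cont n x).add (d.Cc x)) hg z
  choose p hpc hp0 hpd using hp
  obtain ⟨G, hG⟩ : ∃ G, ∀ τ ∈ Icc (0:ℝ) T, ‖g τ‖ ≤ G :=
    isCompact_Icc.exists_bound_of_continuousOn hg.continuousOn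
  obtain ⟨B, hB⟩ : ∃ B, ∀ τ ∈ Icc (0:ℝ) T,
      ‖gronwallBound (‖z‖ ^ 2) (2 * d.c + 1) (G ^ 2) τ‖ ≤ B :=
    isCompact_Icc.exists_bound_of_continuousOn
      (fun τ _ => (hasDerivAt_gronwallBound _ _ _ τ).continuousAt.continuousWithinAt)
  have hB0 : 0 ≤ B := (norm_nonneg _).trans (hB 0 ⟨le_rfl, d.hT⟩)
  have hpB : ∀ n, ∀ τ ∈ Icc (0:ℝ) T, ‖p n τ‖ ^ 2 ≤ B := by
    intro n τ hτ
    have := energy_gronwall (e := p n) (K := 2 * d.c + 1) (ε := G ^ 2) (hpd n) (fun σ hσ => by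
      rw [_root_.add_apply, inner_add_right, inner_add_right]
      have h1 := d.diss1 n σ (p n σ)
      have h2 := real_inner_le_norm (p n σ) (d.C σ (p n σ))
      have h3 := real_inner_le_norm (p n σ) (g σ)
      have h4 := mul_le_mul_of_nonneg_left (d.Cle σ (p n σ)) (norm_nonneg (p n σ))
      have h5 := hG σ hσ
      have h6 := mul_le_mul_of_nonneg_left h5 (norm_nonneg (p n σ))
      nlinarith [sq_nonneg (‖p n σ‖ - G)]) τ hτ
    rw [hp0] at this
    exact this.trans ((le_abs_self _).trans (hB τ hτ))
  have hYB : ∀ n, ∀ τ ∈ Icc (0:ℝ) T, ‖d.Y n τ (d.J 0 τ (p n τ))‖ ≤ 2 * √B := by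
    intro n τ hτ
    rw [d.YR]
    have h1 := d.Jle n τ (d.J 0 τ (p n τ) - p n τ)
    have h2 := norm_sub_le (d.J 0 τ (p n τ)) (p n τ)
    have h3 := d.Jle 0 τ (p n τ)
    have h4 : ‖p n τ‖ ≤ √B := Real.le_sqrt_of_sq_le (hpB n τ hτ)
    linarith
  have hsol : ∀ n, d.IsSol n (fun τ => d.J 0 τ (g τ)) (d.J 0 0 z) (fun τ => d.J 0 τ (p n τ)) := by
    intro n
    refine ⟨continuous_apply_of_bdd (d.Jn 0) (d.Jc 0) (hpc n), by simp [hp0], fun τ hτ => ?_⟩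
    have := d.Rprod hτ (hpd n τ hτ)
    convert this using 1
    simp only [_root_.add_apply, map_add, d.RY]
    abel
  refine ⟨fun n τ => d.J 0 τ (p n τ), 16 * B * T, by have := d.hT; positivity, hsol, ?_⟩
  intro n m τ hτ
  have hk : ∀ (k : ℕ) σ (x : H), x = d.J k σ x - (1 / ((k:ℝ) + 1)) • d.Y k σ x := by
    intro k σ x
    rw [d.Y_apply, smul_smul, one_div, inv_mul_cancel₀ (by positivity), one_smul]
    abel
  have h := energy_gronwall (T := T) (K := 0)
    (ε := 16 * B * (1 / ((n:ℝ) + 1) + 1 / ((m:ℝ) + 1)))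
    (e := fun τ => d.J 0 τ (p n τ) - d.J 0 τ (p m τ))
    (fun σ hσ => ((hsol n).2.2 σ hσ).sub ((hsol m).2.2 σ hσ)) (fun σ hσ => by
      set a := d.J 0 σ (p n σ) with ha
      set b := d.J 0 σ (p m σ) with hb
      have h1 : d.Y n σ a + d.J 0 σ (g σ) - (d.Y m σ b + d.J 0 σ (g σ)) =
          d.Y n σ a - d.Y m σ b := by abel
      have h2 : a - b = (d.J n σ a - d.J m σ b) -
          ((1 / ((n:ℝ) + 1)) • d.Y n σ a - (1 / ((m:ℝ) + 1)) • d.Y m σ b) := by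
        conv_lhs => rw [hk n σ a, hk m σ b]
        abel
      rw [h1]
      have h3 : inner ℝ (a - b) (d.Y n σ a - d.Y m σ b) ≤
          (2 * √B * (1 / ((n:ℝ) + 1) + 1 / ((m:ℝ) + 1))) * (4 * √B) := by
        rw [h2, inner_sub_left]
        have h4 := d.diss n m σ a b
        rw [← d.Y_apply, ← d.Y_apply, real_inner_comm] at h4
        have h5 := (neg_le_abs _).trans (abs_real_inner_le_norm
          ((1 / ((n:ℝ) + 1)) • d.Y n σ a - (1 / ((m:ℝ) + 1)) • d.Y m σ b)
          (d.Y n σ a - d.Y m σ b))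
        have hn := hYB n σ hσ
        have hm := hYB m σ hσ
        have h6 : ‖d.Y n σ a - d.Y m σ b‖ ≤ 4 * √B := by
          have := norm_sub_le (d.Y n σ a) (d.Y m σ b)
          linarith
        have h7 : ‖(1 / ((n:ℝ) + 1)) • d.Y n σ a - (1 / ((m:ℝ) + 1)) • d.Y m σ b‖ ≤
            2 * √B * (1 / ((n:ℝ) + 1) + 1 / ((m:ℝ) + 1)) := by
          refine (norm_sub_le _ _).trans ?_
          rw [norm_smul, norm_smul, Real.norm_of_nonneg (by positivity),
            Real.norm_of_nonneg (by positivity)]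
          have e1 := mul_le_mul_of_nonneg_left hn (show 0 ≤ 1 / ((n:ℝ) + 1) by positivity)
          have e2 := mul_le_mul_of_nonneg_left hm (show 0 ≤ 1 / ((m:ℝ) + 1) by positivity)
          linarith
        have h8 := mul_le_mul h7 h6 (norm_nonneg _) (by positivity)
        linarith
      have h9 : √B * √B = B := Real.mul_self_sqrt hB0
      have h10 : (2 * √B * (1 / ((n:ℝ) + 1) + 1 / ((m:ℝ) + 1))) * (4 * √B) =
        8 * B * (1 / ((n:ℝ) + 1) + 1 / ((m:ℝ) + 1)) := by
        linear_combination 8 * (1 / ((n:ℝ) + 1) + 1 / ((m:ℝ) + 1)) * h9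
      rw [h10] at h3
      linarith) τ hτ
  simp only [hp0, sub_self, norm_zero, gronwallBound_K0] at h
  refine h.trans ?_
  have : 16 * B * (1 / ((n:ℝ) + 1) + 1 / ((m:ℝ) + 1)) * τ ≤
     16 * B * (1 / ((n:ℝ) + 1) + 1 / ((m:ℝ) + 1)) * T :=
    mul_le_mul_of_nonneg_left hτ.2 (by positivity)
  linarith

end KatoData
end KatoBw


namespace KatoBw
namespace KatoData
variable {H : Type*} [NormedAddCommGroup H] [InnerProductSpace ℝ H] {T : ℝ} (d : KatoData H T)

lemma cauchy [CompleteSpace H] {f : ℝ → H} (hf : Continuous f) (x : H) {w : ℕ → ℝ → H}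
    (hw : ∀ n, d.IsSol n f x (w n)) : UniformCauchySeqOn w atTop (Icc (0:ℝ) T) := by
  rw [Metric.uniformCauchySeqOn_iff]
  intro ε hε
  have hJf : ∀ k, Continuous fun τ => d.J k τ (f τ) := fun k =>
    continuous_apply_of_bdd (d.Jn k) (d.Jc k) hf
  have hlim : Tendsto (fun k => ‖x - d.J k 0 x‖ + ∫ r in (0:ℝ)..T, ‖f r - d.J k r (f r)‖)
      atTop (nhds (0 + ∫ r in (0:ℝ)..T, (0:ℝ))) := by
    refine Tendsto.add ?_ ?_
    · have := ((d.Jlim 0 x).const_sub x).norm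
      simpa using this
    · apply intervalIntegral.tendsto_integral_filter_of_dominated_convergence (fun r => 2 * ‖f r‖)
      · exact Eventually.of_forall fun k => (hf.sub (hJf k)).norm.aestronglyMeasurable
      · refine Eventually.of_forall fun k => Eventually.of_forall fun r _ => ?_
        rw [norm_norm]
        have := d.Jle k r (f r)
        have := norm_sub_le (f r) (d.J k r (f r))
        linarith
      · exact (hf.norm.const_mul 2).intervalIntegrable _ _
      · refine Eventually.of_forall fun r _ => ?_
        have := ((d.Jlim r (f r)).const_sub (f r)).norm
        simpa using this
  simp only [intervalIntegral.integral_zero, add_zero] at hlim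
  obtain ⟨k, hk⟩ := (hlim.eventually_lt_const (show 0 < ε / 3 by positivity)).exists
  have hg : Continuous fun τ => ((k:ℝ) + 1) • f τ - (k:ℝ) • d.J k τ (f τ) :=
    (hf.const_smul _).sub ((hJf k).const_smul _)
  obtain ⟨y, M, hM, hy, hyc⟩ := d.regular hg (((k:ℝ) + 1) • x - (k:ℝ) • d.J k 0 x)
  simp only [d.res] at hy
  have hlim2 : Tendsto (fun n : ℕ => M * (1 / ((n:ℝ) + 1))) atTop (nhds (M * 0)) :=
    tendsto_one_div_add_atTop_nhds_zero_nat.const_mul M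
  rw [mul_zero] at hlim2
  obtain ⟨N, hN⟩ := eventually_atTop.1
    (hlim2.eventually_lt_const (show 0 < (ε / 3) ^ 2 / 2 by positivity))
  refine ⟨N, fun m hm n hn τ hτ => ?_⟩
  have h1 := d.stab' hf (hJf k) (hw m) (hy m) τ hτ
  have h2 := d.stab' hf (hJf k) (hw n) (hy n) τ hτ
  have h3 : ‖y m τ - y n τ‖ < ε / 3 := by
    have a := hyc m n τ hτ
    have b := hN m hm
    have c := hN n hn
    refine lt_of_pow_lt_pow_left₀ 2 (by positivity) ?_
    linarith
  rw [dist_eq_norm]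
  have h4 : w m τ - w n τ = (w m τ - y m τ) + (y m τ - y n τ) - (w n τ - y n τ) := by abel
  rw [h4]
  have h5 := norm_sub_le ((w m τ - y m τ) + (y m τ - y n τ)) (w n τ - y n τ)
  have h6 := norm_add_le (w m τ - y m τ) (y m τ - y n τ)
  linarith

lemma exists_limit [CompleteSpace H] {f : ℝ → H} (hf : Continuous f) (x : H) :
    ∃ (s : C(Icc (0:ℝ) T, H)) (w : ℕ → ℝ → H), (∀ n, d.IsSol n f x (w n)) ∧
      TendstoUniformlyOn w (IccExtend d.hT s) atTop (Icc (0:ℝ) T) := by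
  choose w hw using fun n => d.exists_sol n hf x
  have hc := d.cauchy hf x hw
  have : ∀ τ : ℝ, ∃ l, τ ∈ Icc (0:ℝ) T → Tendsto (fun n => w n τ) atTop (nhds l) := by
    intro τ
    by_cases hτ : τ ∈ Icc (0:ℝ) T
    · obtain ⟨l, hl⟩ := cauchySeq_tendsto_of_complete (hc.cauchySeq hτ)
      exact ⟨l, fun _ => hl⟩
    · exact ⟨0, fun h => absurd h hτ⟩
  choose s hs using this
  have hu := hc.tendstoUniformlyOn_of_tendsto hs
  have hsc : ContinuousOn s (Icc 0 T) :=
    hu.continuousOn (Frequently.of_forall fun n => (hw n).1.continuousOn)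
  refine ⟨⟨fun τ => s τ, continuousOn_iff_continuous_restrict.1 hsc⟩, w, hw, hu.congr_right ?_⟩
  intro τ hτ
  rw [IccExtend_of_mem d.hT _ hτ]
  rfl

theorem exists_v [CompleteSpace H] (y : H) :
    ∃ v : ℝ → H, Continuous v ∧ v 0 = y ∧ ∀ τ ∈ Icc (0:ℝ) T,
      HasDerivWithinAt (fun σ => d.J 0 σ (v σ)) (d.J 0 τ (v τ) - v τ) (Icc 0 T) τ := by
  have hcont : ∀ u : C(Icc (0:ℝ) T, H), Continuous (IccExtend d.hT u) := fun u =>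
    u.continuous.Icc_extend'
  have hcC : ∀ u : C(Icc (0:ℝ) T, H), Continuous fun r => d.C r (IccExtend d.hT u r) :=
    fun u => continuous_apply_of_bdd d.Cn d.Cc (hcont u)
  choose Φ w hw hlim using fun u : C(Icc (0:ℝ) T, H) => d.exists_limit (hcC u) y
  obtain ⟨v, hv⟩ := volterra d.hT Φ d.c0 (by
    intro f g τ
    have h1 : ∀ n, ‖w f n τ - w g n τ‖ ≤
        d.c * ∫ r in (0:ℝ)..τ, ‖IccExtend d.hT f r - IccExtend d.hT g r‖ := by
      intro n
      have := d.stab (hcC f) (hcC g) (hw f n) (hw g n) τ τ.2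
      rw [sub_self, norm_zero, zero_add] at this
      refine this.trans ?_
      rw [← intervalIntegral.integral_const_mul]
      apply intervalIntegral.integral_mono_on τ.2.1
      · exact ((hcC f).sub (hcC g)).norm.intervalIntegrable _ _
      · exact (((hcont f).sub (hcont g)).norm.const_mul _).intervalIntegrable _ _
      · intro r _
        rw [← map_sub]
        exact d.Cle r _
    have h2 := (((hlim f).tendsto_at τ.2).sub ((hlim g).tendsto_at τ.2)).norm
    rw [IccExtend_of_mem d.hT _ τ.2, IccExtend_of_mem d.hT _ τ.2] at h2
    exact le_of_tendsto' h2 h1)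
  set V := IccExtend d.hT v with hV
  have hVc : Continuous V := hcont v
  have hz := hw v
  have hzl := hlim v
  rw [hv, ← hV] at hzl
  set z := w v with hzdef
  have h0T : (0:ℝ) ∈ Icc (0:ℝ) T := ⟨le_rfl, d.hT⟩
  have hV0 : V 0 = y :=
    tendsto_nhds_unique (hzl.tendsto_at h0T) (by simp [fun n => (hz n).2.1])
  have hp : ∀ n : ℕ, ∃ p : ℝ → H, Continuous p ∧ p 0 = y ∧
      ∀ τ ∈ Icc (0:ℝ) T, HasDerivWithinAt p ((d.Y n τ + d.C τ) (p τ) + 0) (Icc 0 T) τ := fun n =>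
    linear_ode d.hT (M := fun τ => d.Y n τ + d.C τ) (K := ((n:ℝ) + 1) * 2 + d.c)
      (fun τ => (norm_add_le _ _).trans (add_le_add (d.Y_norm n τ) (d.Cn τ)))
      (fun x => (d.Y_cont n x).add (d.Cc x)) (f := fun _ => 0) continuous_const y
  choose p hpc hp0 hpd using hp
  have hpz : TendstoUniformlyOn p V atTop (Icc (0:ℝ) T) := by
    rw [Metric.tendstoUniformlyOn_iff]
    intro ε hε
    have hg : Tendsto (fun δ : ℝ => gronwallBound 0 (3 * d.c) (d.c * δ ^ 2) T)
        (nhdsWithin 0 (Ioi 0)) (nhds 0) := by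
      have h1 : Continuous fun δ : ℝ => gronwallBound 0 (3 * d.c) (d.c * δ ^ 2) T :=
        (gronwallBound_continuous_ε 0 (3 * d.c) T).comp (by fun_prop)
      have h2 := h1.tendsto 0
      simp only [ne_eq, OfNat.ofNat_ne_zero, not_false_eq_true, zero_pow, mul_zero,
        gronwallBound_ε0_δ0] at h2
      exact h2.mono_left nhdsWithin_le_nhds
    have hev : ∀ᶠ δ : ℝ in nhdsWithin 0 (Ioi 0), gronwallBound 0 (3 * d.c) (d.c * δ ^ 2) T <
        (ε / 2) ^ 2 ∧ 0 < δ ∧ δ < ε / 2 := by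
      filter_upwards [hg.eventually_lt_const (show 0 < (ε / 2) ^ 2 by positivity),
        self_mem_nhdsWithin, nhdsWithin_le_nhds (Iio_mem_nhds (show 0 < ε / 2 by positivity))]
        with δ h1 h2 h3 using ⟨h1, h2, h3⟩
    obtain ⟨δ, hδg, hδ0, hδε⟩ := hev.exists
    filter_upwards [Metric.tendstoUniformlyOn_iff.1 hzl δ hδ0] with n hn τ hτ
    have h := energy_gronwall (T := T) (e := fun τ => p n τ - z n τ) (K := 3 * d.c)
      (ε := d.c * δ ^ 2) (fun σ hσ => (hpd n σ hσ).sub ((hz n).2.2 σ hσ)) (fun σ hσ => by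
        have e1 : (d.Y n σ + d.C σ) (p n σ) + 0 - (d.Y n σ (z n σ) + d.C σ (V σ)) =
            d.Y n σ (p n σ - z n σ) + (d.C σ (p n σ - z n σ) + d.C σ (z n σ - V σ)) := by
          simp only [_root_.add_apply, map_sub]; abel
        rw [e1, inner_add_right, inner_add_right]
        set e := p n σ - z n σ
        have a1 := d.diss1 n σ e
        have a2 := real_inner_le_norm e (d.C σ e)
        have a3 := real_inner_le_norm e (d.C σ (z n σ - V σ))
        have a4 := mul_le_mul_of_nonneg_left (d.Cle σ e) (norm_nonneg e)
        have a5 := mul_le_mul_of_nonneg_left (d.Cle σ (z n σ - V σ)) (norm_nonneg e)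
        have a6 : ‖z n σ - V σ‖ ≤ δ := by
          have := (hn σ hσ).le
          rwa [dist_comm, dist_eq_norm] at this
        have a7 := mul_le_mul_of_nonneg_left a6 (mul_nonneg d.c0 (norm_nonneg e))
        have a8 := mul_nonneg d.c0 (sq_nonneg (‖e‖ - δ))
        nlinarith) τ hτ
    simp only [hp0, (hz n).2.1, sub_self, norm_zero, ne_eq, OfNat.ofNat_ne_zero, not_false_eq_true,
      zero_pow] at h
    have hmono : gronwallBound 0 (3 * d.c) (d.c * δ ^ 2) τ ≤
        gronwallBound 0 (3 * d.c) (d.c * δ ^ 2) T :=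
      gronwallBound_mono le_rfl (mul_nonneg d.c0 (sq_nonneg _))
        (mul_nonneg (by norm_num) d.c0) hτ.2
    have h2 : ‖p n τ - z n τ‖ < ε / 2 :=
      lt_of_pow_lt_pow_left₀ 2 (by positivity) (by linarith)
    have h3 := hn τ hτ
    have h4 : dist (z n τ) (p n τ) < ε / 2 := by rwa [dist_comm, dist_eq_norm]
    have := dist_triangle (V τ) (z n τ) (p n τ)
    linarith
  have hRV : Continuous fun σ => d.J 0 σ (V σ) := continuous_apply_of_bdd (d.Jn 0) (d.Jc 0) hVc
  have hFc : Continuous fun σ => d.J 0 σ (V σ) - V σ := hRV.sub hVc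
  have hu : ∀ n, ∀ τ ∈ Icc (0:ℝ) T, HasDerivWithinAt (fun σ => d.J 0 σ (p n σ))
      (d.J n τ (d.J 0 τ (p n τ) - p n τ)) (Icc 0 T) τ := by
    intro n τ hτ
    have := d.Rprod hτ (hpd n τ hτ)
    convert this using 1
    simp only [_root_.add_apply, add_zero, map_add, d.RY, d.YR]
    abel
  have hFn : ∀ n, Continuous fun τ => d.J n τ (d.J 0 τ (p n τ) - p n τ) := fun n =>
    continuous_apply_of_bdd (d.Jn n) (d.Jc n)
      ((continuous_apply_of_bdd (d.Jn 0) (d.Jc 0) (hpc n)).sub (hpc n))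
  have h_integ : ∀ n, ∀ τ ∈ Icc (0:ℝ) T, ∫ r in (0:ℝ)..τ, d.J n r (d.J 0 r (p n r) - p n r) =
      d.J 0 τ (p n τ) - d.J 0 0 (p n 0) := by
    intro n τ hτ
    apply intervalIntegral.integral_eq_sub_of_hasDeriv_right_of_le hτ.1
      (f := fun σ => d.J 0 σ (p n σ))
    · exact (continuous_apply_of_bdd (d.Jn 0) (d.Jc 0) (hpc n)).continuousOn
    · intro σ hσ
      have hσ' : σ ∈ Ico 0 T := ⟨hσ.1.le, hσ.2.trans_le hτ.2⟩
      exact (hasDerivWithinAt_Ici_of_Icc hσ' (hu n σ (Ico_subset_Icc_self hσ'))).mono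
        Ioi_subset_Ici_self
    · exact (hFn n).intervalIntegrable _ _
  have hJp : ∀ τ ∈ Icc (0:ℝ) T, Tendsto (fun n => d.J 0 τ (p n τ)) atTop
      (nhds (d.J 0 τ (V τ))) := fun τ hτ =>
    ((d.J 0 τ).continuous.tendsto _).comp (hpz.tendsto_at hτ)
  have hlimint : ∀ τ ∈ Icc (0:ℝ) T, d.J 0 τ (V τ) =
      d.J 0 0 (V 0) + ∫ r in (0:ℝ)..τ, (d.J 0 r (V r) - V r) := by
    intro τ hτ
    obtain ⟨B, hB⟩ : ∃ B, ∀ σ ∈ Icc (0:ℝ) T, ‖V σ‖ ≤ B :=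
      isCompact_Icc.exists_bound_of_continuousOn hVc.continuousOn
    have h1 : Tendsto (fun n => ∫ r in (0:ℝ)..τ, d.J n r (d.J 0 r (p n r) - p n r)) atTop
        (nhds (∫ r in (0:ℝ)..τ, (d.J 0 r (V r) - V r))) := by
      apply intervalIntegral.tendsto_integral_filter_of_dominated_convergence
        (fun r => 2 * (B + 1))
      · exact Eventually.of_forall fun n => (hFn n).aestronglyMeasurable
      · filter_upwards [Metric.tendstoUniformlyOn_iff.1 hpz 1 one_pos] with n hn
        refine Eventually.of_forall fun r hr => ?_
        rw [uIoc_of_le hτ.1] at hr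
        have hr' : r ∈ Icc (0:ℝ) T := ⟨hr.1.le, hr.2.trans hτ.2⟩
        have a1 := d.Jle n r (d.J 0 r (p n r) - p n r)
        have a2 := norm_sub_le (d.J 0 r (p n r)) (p n r)
        have a3 := d.Jle 0 r (p n r)
        have a4 := hn r hr'
        rw [dist_comm, dist_eq_norm] at a4
        have a5 := hB r hr'
        have a6 := norm_sub_norm_le (p n r) (V r)
        linarith
      · exact intervalIntegrable_const
      · refine Eventually.of_forall fun r hr => ?_
        rw [uIoc_of_le hτ.1] at hr
        have hr' : r ∈ Icc (0:ℝ) T := ⟨hr.1.le, hr.2.trans hτ.2⟩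
        exact tendsto_apply (Eventually.of_forall fun n => d.Jn n r) (d.Jlim r _)
          ((hJp r hr').sub (hpz.tendsto_at hr'))
    have h2 := (hJp τ hτ).sub (hJp 0 h0T)
    have h3 := tendsto_nhds_unique h1 (h2.congr fun n => (h_integ n τ hτ).symm)
    rw [h3]; abel
  refine ⟨V, hVc, hV0, fun τ hτ => ?_⟩
  have h1 : HasDerivWithinAt (fun τ => d.J 0 0 (V 0) + ∫ r in (0:ℝ)..τ, (d.J 0 r (V r) - V r))
      (d.J 0 τ (V τ) - V τ) (Icc 0 T) τ :=
    ((hFc.integral_hasStrictDerivAt 0 τ).hasDerivAt.const_add _).hasDerivWithinAt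
  exact h1.congr (fun σ hσ => hlimint σ hσ) (hlimint τ hτ)

end KatoData
end KatoBw


namespace KatoBw

section Gen
variable {X : Type*} [NormedAddCommGroup X] [InnerProductSpace ℂ X]

lemma gen_diss {A : X →ₗ[ℂ] X} {D : Submodule ℂ X}
    (h : NBCS.GeneratesContractionSemigroup A D) {x : X} (hx : x ∈ D) :
    (inner ℂ x (A x)).re ≤ 0 := by
  obtain ⟨T, ⟨_, _, h2⟩, hT⟩ := h
  have h3 : Tendsto (fun r : ℝ => (inner ℂ x (r⁻¹ • (T r x - x))).re) (nhdsWithin 0 (Ioi 0))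
      (nhds ((inner ℂ x (A x)).re)) :=
    (Complex.continuous_re.tendsto _).comp (tendsto_const_nhds.inner (𝕜 := ℂ) (h2 x hx))
  refine le_of_tendsto h3 ?_
  filter_upwards [self_mem_nhdsWithin] with r hr
  have hr : 0 < r := hr
  have e1 : (r⁻¹ • (T r x - x) : X) = ((r⁻¹ : ℝ) : ℂ) • (T r x - x) := (Complex.coe_smul _ _).symm
  rw [e1, inner_smul_right, Complex.re_ofReal_mul]
  refine mul_nonpos_of_nonneg_of_nonpos (by positivity) ?_
  rw [inner_sub_right, Complex.sub_re]
  have h4 : (inner ℂ x (T r x)).re ≤ ‖x‖ * ‖T r x‖ := re_inner_le_norm (𝕜 := ℂ) x (T r x)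
  have h5 : (inner ℂ x x).re = ‖x‖ ^ 2 := inner_self_eq_norm_sq (𝕜 := ℂ) x
  have h6 : ‖T r x‖ ≤ ‖x‖ := by simpa using (T r).le_of_opNorm_le (hT r hr.le) x
  nlinarith [norm_nonneg x]

lemma gen_range [CompleteSpace X] {A : X →ₗ[ℂ] X} {D : Submodule ℂ X}
    (h : NBCS.GeneratesContractionSemigroup A D) {l : ℝ} (hl : 0 < l) (y : X) :
    ∃ x ∈ D, l • x - A x = y := by
  obtain ⟨T, ⟨⟨hT0, hTadd, hTc⟩, h1, h2⟩, hT⟩ := h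
  obtain ⟨x, hx⟩ : ∃ x, x - Real.exp (-l) • T 1 x = y := by
    have hn : ‖(Real.exp (-l) : ℂ) • T 1‖ < 1 := by
      rw [norm_smul]
      have e : ‖(Real.exp (-l) : ℂ)‖ = Real.exp (-l) := by
        rw [Complex.norm_real, Real.norm_of_nonneg (Real.exp_pos _).le]
      rw [e]
      have : Real.exp (-l) < 1 := by rw [Real.exp_lt_one_iff]; linarith
      nlinarith [hT 1 zero_le_one, Real.exp_pos (-l), norm_nonneg (T 1)]
    obtain ⟨u, hu⟩ := isUnit_one_sub_of_norm_lt_one hn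
    refine ⟨(↑u⁻¹ : X →L[ℂ] X) y, ?_⟩
    have : ((u : X →L[ℂ] X) * (↑u⁻¹ : X →L[ℂ] X)) y = y := by simp
    rw [hu] at this
    rw [← Complex.coe_smul]
    simpa [-Complex.ofReal_exp] using this
  let g : ℝ → X := fun r => Real.exp (-l * r) • T (max r 0) x
  have hg : Continuous g := by
    have : Continuous fun r : ℝ => T (max r 0) x :=
      (hTc x).comp_continuous (by fun_prop) (fun r => mem_Ici.2 (le_max_right _ _))
    have h0 : Continuous fun r : ℝ => Real.exp (-l * r) := by fun_prop
    exact h0.smul this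
  let F : ℝ → X := fun r => ∫ s in (0:ℝ)..r, g s
  have hF : ∀ r, HasDerivAt F (g r) r := fun r => (hg.integral_hasStrictDerivAt 0 r).hasDerivAt
  have hF0 : F 0 = 0 := by simp [F]
  let P : ℝ → X := fun r => Real.exp (l * r) • (F (1 + r) - F r)
  have hP : HasDerivAt P (l • F 1 + (Real.exp (-l) • T 1 x - x)) 0 := by
    have d1 : HasDerivAt (fun r : ℝ => Real.exp (l * r)) l 0 := by
      simpa using ((hasDerivAt_id (0:ℝ)).const_mul l).exp
    have d2 : HasDerivAt (fun r : ℝ => F (1 + r)) (g 1) 0 := by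
      have := hF (1 + 0)
      simpa using this.comp_const_add 1 0
    have d3 := d1.smul (d2.sub (hF 0))
    have e : l • F 1 + (Real.exp (-l) • T 1 x - x) =
        Real.exp (l * 0) • (g 1 - g 0) + l • ((fun r => F (1 + r)) - F) 0 := by
      simp [g, hF0, hT0, add_comm]
    rw [e]
    exact d3
  have hP0 : P 0 = F 1 := by simp [P, hF0]
  have hPT : ∀ r, 0 < r → T r (F 1) = P r := by
    intro r hr
    have e1 : T r (F 1) = ∫ s in (0:ℝ)..1, T r (g s) :=
      ((T r).intervalIntegral_comp_comm (hg.intervalIntegrable 0 1)).symm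
    have e2 : ∫ s in (0:ℝ)..1, T r (g s) = ∫ s in (0:ℝ)..1, Real.exp (l * r) • g (r + s) := by
      refine intervalIntegral.integral_congr fun s hs => ?_
      rw [uIcc_of_le zero_le_one] at hs
      simp only [g]
      rw [← Complex.coe_smul, map_smul, Complex.coe_smul, max_eq_left hs.1,
        max_eq_left (by linarith [hs.1]), hTadd r s hr.le hs.1, smul_smul, ← Real.exp_add]
      congr 2
      ring
    rw [e1, e2, intervalIntegral.integral_smul, intervalIntegral.integral_comp_add_left]
    simp only [P, F]
    rw [add_zero, add_comm r 1,
      intervalIntegral.integral_interval_sub_left (hg.intervalIntegrable _ _) (hg.intervalIntegrable _ _)]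
  have hlim : Tendsto (fun r : ℝ => r⁻¹ • (T r (F 1) - F 1)) (nhdsWithin 0 (Ioi 0))
      (nhds (l • F 1 + (Real.exp (-l) • T 1 x - x))) := by
    have := hP.hasDerivWithinAt (s := Ioi 0)
    rw [hasDerivWithinAt_iff_tendsto_slope' (by simp)] at this
    refine this.congr' ?_
    filter_upwards [self_mem_nhdsWithin] with r hr
    rw [slope_def_module, hPT r hr, hP0, sub_zero]
  have hmem : F 1 ∈ D := (h1 _).2 ⟨_, hlim⟩
  refine ⟨F 1, hmem, ?_⟩
  rw [tendsto_nhds_unique (h2 _ hmem) hlim, ← hx]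
  abel

lemma gen_dense [CompleteSpace X] {A : X →ₗ[ℂ] X} {D : Submodule ℂ X}
    (h : NBCS.GeneratesContractionSemigroup A D) : Dense (D : Set X) := by
  rw [Submodule.dense_iff_topologicalClosure_eq_top, Submodule.topologicalClosure_eq_top_iff, Submodule.eq_bot_iff]
  intro z hz
  obtain ⟨x, hx, e⟩ := gen_range h one_pos z
  have h1 := gen_diss h hx
  have h2 : inner ℂ x z = 0 := (Submodule.mem_orthogonal _ _).1 hz x hx
  rw [← e, one_smul, inner_sub_right, sub_eq_zero] at h2
  rw [← h2] at h1
  have h5 : (inner ℂ x x).re = ‖x‖ ^ 2 := inner_self_eq_norm_sq (𝕜 := ℂ) x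
  have : x = 0 := by rw [← norm_eq_zero]; nlinarith [norm_nonneg x]
  rw [← e, this]; simp

end Gen
end KatoBw


namespace KatoBw

section Build
variable {H : Type*} [NormedAddCommGroup H] [InnerProductSpace ℝ H]

lemma res_bound {L : H →ₗ[ℝ] H} {D : Submodule ℝ H}
    (hd : ∀ x ∈ D, inner ℝ x (L x) ≤ 0) {k : ℝ} {x : H} (hx : x ∈ D) :
    k * ‖x‖ ≤ ‖k • x - L x‖ := by
  have h1 : inner ℝ x (k • x - L x) = k * ‖x‖ ^ 2 - inner ℝ x (L x) := by
    rw [inner_sub_right, inner_smul_right, real_inner_self_eq_norm_sq]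
  have h2 := real_inner_le_norm x (k • x - L x)
  have h3 := hd x hx
  rcases eq_or_lt_of_le (norm_nonneg x) with h | h
  · rw [← h]; simp
  · nlinarith

lemma exists_res {L : H →ₗ[ℝ] H} {D : Submodule ℝ H}
    (hd : ∀ x ∈ D, inner ℝ x (L x) ≤ 0) {k : ℝ} (hk : 0 < k)
    (hs : ∀ y, ∃ x ∈ D, k • x - L x = y) :
    ∃ J : H →L[ℝ] H, ‖J‖ ≤ 1 ∧ (∀ y, J y ∈ D) ∧ (∀ y, k • J y - L (J y) = k • y) ∧
      ∀ x ∈ D, J (k • x - L x) = k • x := by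
  have inj : ∀ x ∈ D, ∀ x' ∈ D, k • x - L x = k • x' - L x' → x = x' := by
    intro x hx x' hx' e
    have := res_bound hd (k := k) (D.sub_mem hx hx')
    have e2 : k • (x - x') - L (x - x') = 0 := by
      rw [smul_sub, map_sub]; rw [← sub_eq_zero] at e; rw [← e]; abel
    rw [e2, norm_zero] at this
    have : ‖x - x'‖ = 0 := by
      refine le_antisymm ?_ (norm_nonneg _)
      by_contra! hh
      nlinarith
    rwa [norm_eq_zero, sub_eq_zero] at this
  choose f hfD hf using fun y => hs (k • y)
  let F : H →ₗ[ℝ] H :=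
    { toFun := f
      map_add' := fun y z => inj _ (hfD _) _ (D.add_mem (hfD _) (hfD _)) (by
        rw [hf, smul_add, smul_add, map_add, ← hf y, ← hf z]; abel)
      map_smul' := fun c y => inj _ (hfD _) _ (D.smul_mem _ (hfD _)) (by
        rw [hf, RingHom.id_apply, map_smul, smul_comm k c, smul_comm k c, ← smul_sub, hf]) }
  have hb : ∀ y, ‖F y‖ ≤ 1 * ‖y‖ := by
    intro y
    have := res_bound hd (k := k) (hfD y)
    rw [hf, norm_smul, Real.norm_of_nonneg hk.le] at this
    rw [one_mul]
    exact le_of_mul_le_mul_left this hk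
  refine ⟨F.mkContinuous 1 hb, F.mkContinuous_norm_le zero_le_one hb, hfD, hf, ?_⟩
  intro x hx
  refine inj _ (hfD _) _ (D.smul_mem _ hx) ?_
  rw [hf, map_smul, smul_sub]

variable (H) in
structure BData (T : ℝ) where
  B : ℝ → H →ₗ[ℝ] H
  B' : ℝ → H → H
  D : Submodule ℝ H
  hT : 0 < T
  diss : ∀ τ, ∀ x ∈ D, inner ℝ x (B τ x) ≤ 0
  surj : ∀ τ, ∀ k : ℝ, 0 < k → ∀ y, ∃ x ∈ D, k • x - B τ x = y
  dense : Dense (D : Set H)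
  Bc : ∀ x ∈ D, Continuous fun τ => B τ x
  B'c : ∀ x ∈ D, Continuous fun τ => B' τ x
  der : ∀ x ∈ D, ∀ τ ∈ Icc 0 T, HasDerivWithinAt (fun σ => B σ x) (B' τ x) (Icc 0 T) τ
  clamp : ∀ τ, ∃ τ' ∈ Icc 0 T, B τ = B τ' ∧ B' τ = B' τ'

namespace BData
variable {T : ℝ} (b : BData H T)

lemma exJ (n : ℕ) (τ : ℝ) : ∃ J : H →L[ℝ] H, ‖J‖ ≤ 1 ∧ (∀ y, J y ∈ b.D) ∧
    (∀ y, ((n:ℝ)+1) • J y - b.B τ (J y) = ((n:ℝ)+1) • y) ∧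
      ∀ x ∈ b.D, J (((n:ℝ)+1) • x - b.B τ x) = ((n:ℝ)+1) • x :=
  exists_res (b.diss τ) (by positivity) (b.surj τ _ (by positivity))

noncomputable def J (n : ℕ) (τ : ℝ) : H →L[ℝ] H := (b.exJ n τ).choose

lemma Jn (n τ) : ‖b.J n τ‖ ≤ 1 := (b.exJ n τ).choose_spec.1
lemma Jle (n τ x) : ‖b.J n τ x‖ ≤ ‖x‖ := by simpa using (b.J n τ).le_of_opNorm_le (b.Jn n τ) x
lemma JD (n τ y) : b.J n τ y ∈ b.D := (b.exJ n τ).choose_spec.2.1 y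
lemma BJ (n τ y) : b.B τ (b.J n τ y) = ((n:ℝ)+1) • (b.J n τ y - y) := by
  rw [smul_sub, ← (b.exJ n τ).choose_spec.2.2.1 y]
  simp only [J]; abel
lemma JB (n τ) {x} (hx : x ∈ b.D) : b.J n τ (((n:ℝ)+1) • x - b.B τ x) = ((n:ℝ)+1) • x :=
  (b.exJ n τ).choose_spec.2.2.2 x hx
lemma JB' (n τ) {x} (hx : x ∈ b.D) : b.J n τ (b.B τ x) = ((n:ℝ)+1) • (b.J n τ x - x) := by
  have := b.JB n τ hx
  rw [map_sub, map_smul] at this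
  rw [smul_sub, ← this]; abel

lemma JB0 (τ) {x} (hx : x ∈ b.D) : b.J 0 τ (x - b.B τ x) = x := by
  simpa using b.JB 0 τ hx
lemma BJ0 (τ y) : b.B τ (b.J 0 τ y) = b.J 0 τ y - y := by
  simpa using b.BJ 0 τ y

lemma res (n : ℕ) (τ : ℝ) (x : H) :
    b.J 0 τ (((n:ℝ)+1)•x - (n:ℝ)•b.J n τ x) = b.J n τ x := by
  conv_rhs => rw [← b.JB0 τ (b.JD n τ x), b.BJ]
  congr 1
  module

lemma comm (n : ℕ) (τ : ℝ) (x : H) : b.J 0 τ (b.J n τ x) = b.J n τ (b.J 0 τ x) := by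
  have h1 := b.JB' n τ (b.JD 0 τ x)
  rw [b.BJ0, map_sub] at h1
  have h2 : b.J n τ x = b.J n τ (b.J 0 τ x) - b.B τ (b.J n τ (b.J 0 τ x)) := by
    rw [b.BJ, ← h1]; abel
  rw [h2, b.JB0 τ (b.JD _ _ _)]

lemma diss' (n m : ℕ) (τ : ℝ) (x y : H) :
    inner ℝ (((n:ℝ)+1)•(b.J n τ x - x) - ((m:ℝ)+1)•(b.J m τ y - y)) (b.J n τ x - b.J m τ y) ≤ 0 := by
  rw [← b.BJ, ← b.BJ, ← map_sub, real_inner_comm]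
  exact b.diss τ _ (b.D.sub_mem (b.JD _ _ _) (b.JD _ _ _))

lemma Jdiff (n σ τ x) : b.J n σ x - b.J n τ x =
    ((n:ℝ)+1)⁻¹ • b.J n σ (b.B σ (b.J n τ x) - b.B τ (b.J n τ x)) := by
  have hn : ((n:ℝ)+1) ≠ 0 := by positivity
  rw [map_sub, b.JB' n σ (b.JD _ _ _), b.BJ, map_smul, map_sub]
  rw [eq_inv_smul_iff₀ hn]
  module

lemma Jc (n x) : Continuous fun τ => b.J n τ x := by
  rw [continuous_iff_continuousAt]
  intro τ
  rw [ContinuousAt, tendsto_iff_norm_sub_tendsto_zero]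
  have h1 : Tendsto (fun σ => ((n:ℝ)+1)⁻¹ * ‖b.B σ (b.J n τ x) - b.B τ (b.J n τ x)‖) (nhds τ) (nhds 0) := by
    have := ((((b.Bc _ (b.JD n τ x)).tendsto τ).sub_const (b.B τ (b.J n τ x))).norm).const_mul ((n:ℝ)+1)⁻¹
    simpa using this
  refine squeeze_zero (fun _ => norm_nonneg _) (fun σ => ?_) h1
  rw [b.Jdiff, norm_smul, Real.norm_of_nonneg (by positivity)]
  exact mul_le_mul_of_nonneg_left (b.Jle _ _ _) (by positivity)

lemma Jlim (τ x) : Tendsto (fun n => b.J n τ x) atTop (nhds x) := by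
  have hD : ∀ y ∈ b.D, Tendsto (fun n => b.J n τ y) atTop (nhds y) := by
    intro y hy
    rw [tendsto_iff_norm_sub_tendsto_zero]
    have h1 : Tendsto (fun n : ℕ => ‖b.B τ y‖ * (1 / ((n:ℝ)+1))) atTop (nhds 0) := by
      simpa using tendsto_one_div_add_atTop_nhds_zero_nat.const_mul ‖b.B τ y‖
    refine squeeze_zero (fun _ => norm_nonneg _) (fun n => ?_) h1
    have hn : 0 < ((n:ℝ)+1) := by positivity
    have h2 := b.Jle n τ (b.B τ y)
    rw [b.JB' n τ hy, norm_smul, Real.norm_of_nonneg hn.le] at h2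
    rw [mul_one_div, le_div_iff₀ hn, mul_comm]
    exact h2
  rw [Metric.tendsto_atTop]
  intro ε hε
  obtain ⟨y, hy, hxy⟩ := b.dense.exists_dist_lt x (show 0 < ε/3 by positivity)
  obtain ⟨N, hN⟩ := Metric.tendsto_atTop.1 (hD y hy) (ε/3) (by positivity)
  refine ⟨N, fun n hn => ?_⟩
  have h1 : dist (b.J n τ x) (b.J n τ y) ≤ dist x y := by
    rw [dist_eq_norm, dist_eq_norm, ← map_sub]; exact b.Jle _ _ _
  have h2 := hN n hn
  have h3 := dist_triangle4 (b.J n τ x) (b.J n τ y) y x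
  rw [dist_comm y x] at h3
  linarith

lemma Rder (x) (τ) (hτ : τ ∈ Icc 0 T) :
    HasDerivWithinAt (fun σ => b.J 0 σ x) (b.J 0 τ (b.B' τ (b.J 0 τ x))) (Icc 0 T) τ := by
  rw [hasDerivWithinAt_iff_tendsto_slope]
  have h1 := hasDerivWithinAt_iff_tendsto_slope.1 (b.der _ (b.JD 0 τ x) τ hτ)
  have h2 : Tendsto (fun σ => b.J 0 σ (b.B' τ (b.J 0 τ x))) (nhdsWithin τ (Icc 0 T \ {τ}))
      (nhds (b.J 0 τ (b.B' τ (b.J 0 τ x)))) :=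
    ((b.Jc 0 _).tendsto τ).mono_left nhdsWithin_le_nhds
  have h3 := tendsto_apply (K := 1) (Eventually.of_forall fun σ => b.Jn 0 σ) h2 h1
  refine h3.congr fun σ => ?_
  rw [slope_def_module, slope_def_module, b.Jdiff, map_smul]
  simp

end BData
end Build
end KatoBw


namespace KatoBw

namespace BData
variable {H : Type*} [NormedAddCommGroup H] [InnerProductSpace ℝ H] [CompleteSpace H]
variable {T : ℝ} (b : BData H T)

/-- `B(τ) (1 - B(0))⁻¹` as a bounded operator. -/
noncomputable def G (τ : ℝ) : H →L[ℝ] H :=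
  ContinuousLinearMap.ofSeqClosedGraph (g := (b.B τ).comp (b.J 0 0 : H →ₗ[ℝ] H)) (by
    intro u x y hu hy
    have h1 : Tendsto (fun n => b.J 0 0 (u n)) atTop (nhds (b.J 0 0 x)) :=
      ((b.J 0 0).continuous.tendsto x).comp hu
    have h2 := ((b.J 0 τ).continuous.tendsto _).comp (h1.sub hy)
    have h3 : Tendsto (fun n => b.J 0 0 (u n)) atTop (nhds (b.J 0 τ (b.J 0 0 x - y))) := by
      refine h2.congr fun n => ?_
      exact b.JB0 τ (b.JD 0 0 (u n))
    have h4 := tendsto_nhds_unique h1 h3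
    show y = b.B τ (b.J 0 0 x)
    have h5 := b.BJ0 τ (b.J 0 0 x - y)
    rw [← h4] at h5
    rw [h5]; abel)

lemma G_apply (τ x) : b.G τ x = b.B τ (b.J 0 0 x) := rfl

lemma exists_lip : ∃ L : ℝ, 0 ≤ L ∧ ∀ σ τ, σ ∈ Icc 0 T → τ ∈ Icc 0 T →
    ‖b.G σ - b.G τ‖ ≤ L * |σ - τ| := by
  obtain ⟨L, hL⟩ := banach_steinhaus
    (g := fun p : Icc 0 T × Icc 0 T => (p.1.1 - p.2.1)⁻¹ • (b.G p.1.1 - b.G p.2.1)) (by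
      intro x
      have hz := b.JD 0 0 x
      obtain ⟨M, hM⟩ := isCompact_Icc.exists_bound_of_continuousOn
        (s := Icc 0 T) (b.B'c _ hz).continuousOn
      refine ⟨M, fun p => ?_⟩
      have h1 := (convex_Icc 0 T).norm_image_sub_le_of_norm_hasDerivWithin_le
        (fun τ hτ => b.der _ hz τ hτ) hM p.2.2 p.1.2
      show ‖(p.1.1 - p.2.1)⁻¹ • (b.B p.1.1 (b.J 0 0 x) - b.B p.2.1 (b.J 0 0 x))‖ ≤ M
      have hM0 : 0 ≤ M := (norm_nonneg _).trans (hM p.1.1 p.1.2)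
      rw [norm_smul, norm_inv]
      refine (mul_le_mul_of_nonneg_left h1 (by positivity)).trans ?_
      rcases eq_or_ne (‖p.1.1 - p.2.1‖) 0 with h | h
      · rw [h]; simpa using hM0
      · rw [mul_comm M, inv_mul_cancel_left₀ h])
  have hL0 : 0 ≤ L := (norm_nonneg _).trans (hL (⟨0, by simp [b.hT.le]⟩, ⟨0, by simp [b.hT.le]⟩))
  refine ⟨L, hL0, fun σ τ hσ hτ => ?_⟩
  rcases eq_or_ne σ τ with rfl | h
  · simp
  have := hL (⟨σ, hσ⟩, ⟨τ, hτ⟩)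
  have h' : 0 < |σ - τ| := abs_pos.2 (sub_ne_zero.2 h)
  simp only [norm_smul, norm_inv, Real.norm_eq_abs] at this
  rwa [inv_mul_le_iff₀ h', mul_comm] at this

/-- `(1 - B(τ)) (1 - B(0))⁻¹`. -/
noncomputable def P (τ : ℝ) : H →L[ℝ] H := b.J 0 0 - b.G τ

lemma P_apply (τ x) : b.P τ x = b.J 0 0 x - b.B τ (b.J 0 0 x) := rfl

lemma P_unit (τ) : IsUnit (b.P τ) := by
  rw [ContinuousLinearMap.isUnit_iff_bijective]
  constructor
  · intro x y h
    rw [b.P_apply, b.P_apply] at h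
    have h1 := congrArg (b.J 0 τ) h
    rw [b.JB0 _ (b.JD _ _ _), b.JB0 _ (b.JD _ _ _)] at h1
    have h2 := congrArg (b.B 0) h1
    rw [b.BJ0, b.BJ0, h1] at h2
    simpa using h2
  · intro y
    refine ⟨b.J 0 τ y - b.B 0 (b.J 0 τ y), ?_⟩
    rw [b.P_apply, b.JB0 _ (b.JD _ _ _), b.BJ0]
    abel

noncomputable def S (τ : ℝ) : H →L[ℝ] H := Ring.inverse (b.P τ)

lemma J0_eq (τ x) : b.J 0 τ x = b.J 0 0 (b.S τ x) := by
  have h1 : b.P τ (b.S τ x) = x := by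
    have := Ring.mul_inverse_cancel _ (b.P_unit τ)
    exact congrArg (fun M : H →L[ℝ] H => M x) this
  conv_lhs => rw [← h1, b.P_apply, b.JB0 _ (b.JD _ _ _)]

lemma G_contOn : ContinuousOn b.G (Icc 0 T) := by
  obtain ⟨L, hL0, hL⟩ := b.exists_lip
  have : LipschitzOnWith ⟨L, hL0⟩ b.G (Icc 0 T) := by
    refine LipschitzOnWith.of_dist_le_mul fun σ hσ τ hτ => ?_
    rw [dist_eq_norm, Real.dist_eq]
    exact hL σ τ hσ hτ
  exact this.continuousOn

lemma S_contOn : ContinuousOn b.S (Icc 0 T) := by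
  intro τ hτ
  have h1 : ContinuousWithinAt b.P (Icc 0 T) τ := continuousWithinAt_const.sub (b.G_contOn τ hτ)
  obtain ⟨u, hu⟩ := b.P_unit τ
  have h2 := NormedRing.inverse_continuousAt u
  rw [hu] at h2
  exact h2.comp_continuousWithinAt h1

lemma G_clamp {τ τ'} (h : b.B τ = b.B τ') : b.G τ = b.G τ' := by
  ext x; rw [G_apply, G_apply, h]

lemma S_clamp {τ τ'} (h : b.B τ = b.B τ') : b.S τ = b.S τ' := by
  rw [S, S, P, P, b.G_clamp h]

lemma S_bdd : ∃ M : ℝ, ∀ τ, ‖b.S τ‖ ≤ M := by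
  obtain ⟨M, hM⟩ := isCompact_Icc.exists_bound_of_continuousOn b.S_contOn
  refine ⟨M, fun τ => ?_⟩
  obtain ⟨τ', h, h1, -⟩ := b.clamp τ
  rw [b.S_clamp h1]; exact hM _ h

lemma S_eq (τ x) : b.S τ x = b.J 0 τ x - b.B 0 (b.J 0 τ x) := by
  rw [b.J0_eq, b.BJ0]; abel

lemma S_cont (x) : Continuous fun τ => b.S τ x := by
  obtain ⟨M, hM⟩ := b.S_bdd
  rw [continuous_iff_continuousAt]
  intro τ
  rw [ContinuousAt, tendsto_iff_norm_sub_tendsto_zero]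
  have h1 : Tendsto (fun σ => M * ‖b.B σ (b.J 0 τ x) - b.B τ (b.J 0 τ x)‖) (nhds τ) (nhds 0) := by
    have := ((((b.Bc _ (b.JD 0 τ x)).tendsto τ).sub_const (b.B τ (b.J 0 τ x))).norm).const_mul M
    simpa using this
  refine squeeze_zero (fun _ => norm_nonneg _) (fun σ => ?_) h1
  have e : b.S σ x - b.S τ x = b.S σ (b.B σ (b.J 0 τ x) - b.B τ (b.J 0 τ x)) := by
    have h0 := b.Jdiff 0 σ τ x
    simp only [Nat.cast_zero, zero_add, inv_one, one_smul] at h0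
    rw [b.S_eq, b.S_eq, b.S_eq, ← h0, map_sub]
    abel
  rw [e]
  exact (b.S σ).le_of_opNorm_le (hM σ) _

lemma B'_uniq (b : BData H T) {τ} (hτ : τ ∈ Icc 0 T) {f : ℝ → H} {a c : H}
    (h1 : HasDerivWithinAt f a (Icc 0 T) τ) (h2 : HasDerivWithinAt f c (Icc 0 T) τ) : a = c :=
  UniqueDiffWithinAt.eq_deriv _ (uniqueDiffOn_Icc b.hT τ hτ) h1 h2

lemma exists_G' : ∃ L : ℝ, 0 ≤ L ∧ ∀ τ, ∃ G' : H →L[ℝ] H, ‖G'‖ ≤ L ∧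
    ∀ x, G' x = b.B' τ (b.J 0 0 x) := by
  obtain ⟨L, hL0, hL⟩ := b.exists_lip
  refine ⟨L, hL0, fun τ => ?_⟩
  obtain ⟨τ', h, -, h2⟩ := b.clamp τ
  rw [h2]
  let F : H →ₗ[ℝ] H :=
    { toFun := fun x => b.B' τ' (b.J 0 0 x)
      map_add' := fun x y => b.B'_uniq h (b.der _ (b.JD _ _ _) τ' h) (by
        simp only [map_add]
        exact (b.der _ (b.JD 0 0 x) τ' h).add (b.der _ (b.JD 0 0 y) τ' h))
      map_smul' := fun c x => b.B'_uniq h (b.der _ (b.JD _ _ _) τ' h) (by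
        simp only [map_smul]
        exact (b.der _ (b.JD 0 0 x) τ' h).const_smul c) }
  have hb : ∀ x, ‖F x‖ ≤ L * ‖x‖ := by
    intro x
    have h1 := b.der _ (b.JD 0 0 x) τ' h
    have : (nhdsWithin τ' (Icc 0 T \ {τ'})).NeBot := by
      have := (uniqueDiffOn_Icc b.hT τ' h).accPt
      rwa [accPt_principal_iff_nhdsWithin] at this
    rw [hasDerivWithinAt_iff_tendsto_slope] at h1
    refine le_of_tendsto h1.norm ?_
    filter_upwards [self_mem_nhdsWithin] with σ hσ
    have h3 : 0 < |σ - τ'| := abs_pos.2 (sub_ne_zero.2 hσ.2)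
    rw [slope_def_module, norm_smul, norm_inv, Real.norm_eq_abs, inv_mul_le_iff₀ h3]
    have := (b.G σ - b.G τ').le_of_opNorm_le (hL σ τ' hσ.1 h) x
    rw [sub_apply, b.G_apply, b.G_apply] at this
    linarith
  exact ⟨F.mkContinuous L hb, F.mkContinuous_norm_le hL0 hb, fun x => rfl⟩

theorem exists_C : ∃ (c : ℝ) (C : ℝ → H →L[ℝ] H), (∀ τ, ‖C τ‖ ≤ c) ∧
    (∀ x, Continuous fun τ => C τ x) ∧ ∀ τ x, C τ x = - b.B' τ (b.J 0 τ x) := by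
  obtain ⟨L, hL0, h⟩ := b.exists_G'
  obtain ⟨M, hM⟩ := b.S_bdd
  choose G' hG' hG'a using h
  refine ⟨L * M, fun τ => - (G' τ).comp (b.S τ), fun τ => ?_, fun x => ?_, fun τ x => ?_⟩
  · rw [norm_neg]
    exact ((G' τ).opNorm_comp_le _).trans (mul_le_mul (hG' τ) (hM τ) (norm_nonneg _) hL0)
  · have h1 : ∀ y, Continuous fun τ => G' τ y := fun y => by
      simp only [hG'a]; exact b.B'c _ (b.JD _ _ _)
    have h2 := continuous_apply_of_bdd hG' h1 (b.S_cont x)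
    exact h2.neg
  · show - G' τ (b.S τ x) = _
    rw [hG'a, ← b.J0_eq]

theorem exists_u (x : H) (hx : x ∈ b.D) : ∃ u : ℝ → H, Continuous (fun τ => b.B τ (u τ)) ∧
    u 0 = x ∧ (∀ τ, u τ ∈ b.D) ∧
    ∀ τ ∈ Icc 0 T, HasDerivWithinAt u (b.B τ (u τ)) (Icc 0 T) τ := by
  obtain ⟨c, C, hC, hCc, hCa⟩ := b.exists_C
  let d : KatoData H T :=
    { J := b.J, C := C, c := c, hT := b.hT.le, Jn := b.Jn, Jc := b.Jc, Jlim := b.Jlim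
      Cn := hC, Cc := hCc, res := b.res, comm := b.comm, diss := b.diss'
      Rder := fun x τ hτ => by
        have := b.Rder x τ hτ
        rwa [hCa, map_neg, neg_neg] }
  obtain ⟨v, hv, hv0, hder⟩ := d.exists_v (x - b.B 0 x)
  have hder' : ∀ τ ∈ Icc 0 T, HasDerivWithinAt (fun σ => b.J 0 σ (v σ)) (b.J 0 τ (v τ) - v τ) (Icc 0 T) τ := hder
  refine ⟨fun τ => b.J 0 τ (v τ), ?_, ?_, fun τ => b.JD _ _ _, ?_⟩
  · simp only [b.BJ0]
    exact (continuous_apply_of_bdd (b.Jn 0) (b.Jc 0) hv).sub hv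
  · show b.J 0 0 (v 0) = x
    rw [hv0, b.JB0 0 hx]
  · intro τ hτ
    rw [b.BJ0]
    exact hder' τ hτ

end BData
end KatoBw


namespace KatoBw

section Cplx
variable {X : Type*} [NormedAddCommGroup X] [InnerProductSpace ℂ X]

lemma energy_c {T : ℝ} {e e' : ℝ → X} {φ : ℝ → ℝ} (hφ : Continuous φ)
    (he : ∀ τ ∈ Icc (0:ℝ) T, HasDerivWithinAt e (e' τ) (Icc 0 T) τ)
    (h0 : ∀ τ ∈ Icc (0:ℝ) T, 0 ≤ φ τ)
    (h : ∀ τ ∈ Icc (0:ℝ) T, (inner ℂ (e τ) (e' τ)).re ≤ ‖e τ‖ * φ τ) :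
    ∀ τ ∈ Icc (0:ℝ) T, ‖e τ‖ ≤ ‖e 0‖ + ∫ r in (0:ℝ)..τ, φ r := by
  letI : InnerProductSpace ℝ X := InnerProductSpace.complexToReal
  exact energy_integral hφ he h0 h

/-- Hypotheses extracted from the elementary Kato class. -/
structure Hyp (A : ℝ → X →ₗ[ℂ] X) (D : Submodule ℂ X) : Prop where
  diss : ∀ t, 0 ≤ t → ∀ x ∈ D, (inner ℂ x (A t x)).re ≤ 0
  surj : ∀ t, 0 ≤ t → ∀ k : ℝ, 0 < k → ∀ y, ∃ x ∈ D, k • x - A t x = y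
  dense : Dense (D : Set X)
  c1 : ∀ x ∈ D, ContDiffOn ℝ 1 (fun t => A t x) (Ici (0:ℝ))

variable {A : ℝ → X →ₗ[ℂ] X} {D : Submodule ℂ X}

noncomputable def κ (T r : ℝ) : ℝ := max 0 (min T r)

lemma κ_mem {T : ℝ} (hT : 0 ≤ T) (r : ℝ) : κ T r ∈ Icc 0 T :=
  ⟨le_max_left _ _, max_le hT (min_le_left _ _)⟩

lemma κ_eq {T r : ℝ} (h : r ∈ Icc 0 T) : κ T r = r := by
  rw [κ, min_eq_right h.2, max_eq_right h.1]

lemma κ_cont (T : ℝ) : Continuous (κ T) := by unfold κ; fun_prop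

/-- The time-reversed data. -/
noncomputable def mkB (hA : Hyp A D) {T : ℝ} (hT : 0 < T) :
    @BData X _ InnerProductSpace.complexToReal T :=
  letI : InnerProductSpace ℝ X := InnerProductSpace.complexToReal
  have hs : ∀ τ, 0 ≤ T - κ T τ := fun τ => by linarith [(κ_mem hT.le τ).2]
  { B := fun τ => (A (T - κ T τ)).restrictScalars ℝ
    B' := fun τ x => - derivWithin (fun t => A t x) (Ici 0) (T - κ T τ)
    D := D.restrictScalars ℝ
    hT := hT
    diss := fun τ x hx => hA.diss _ (hs τ) x hx
    surj := fun τ k hk y => hA.surj _ (hs τ) k hk y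
    dense := hA.dense
    Bc := fun x hx => (hA.c1 x hx).continuousOn.comp_continuous
      (continuous_const.sub (κ_cont T)) (fun τ => hs τ)
    B'c := fun x hx => (((hA.c1 x hx).continuousOn_derivWithin (uniqueDiffOn_Ici 0) le_rfl).comp_continuous
      (continuous_const.sub (κ_cont T)) (fun τ => hs τ)).neg
    der := fun x hx τ hτ => by
      have h1 : HasDerivWithinAt (fun t => A t x) (derivWithin (fun t => A t x) (Ici 0) (T - τ))
          (Ici 0) (T - τ) :=
        ((hA.c1 x hx).differentiableOn one_ne_zero (T - τ) (by
          have := hτ.2; simp only [mem_Ici]; linarith)).hasDerivWithinAt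
      have h2 : HasDerivWithinAt (fun σ : ℝ => T - σ) (-1) (Icc 0 T) τ :=
        (hasDerivWithinAt_id τ _).const_sub T
      have h3 := h1.scomp τ h2 (fun σ hσ => by
        have := hσ.2; simp only [mem_Ici]; linarith)
      rw [κ_eq hτ]
      simp only [neg_smul, one_smul] at h3
      refine h3.congr (fun σ hσ => ?_) ?_
      · simp [κ_eq hσ]
      · simp [κ_eq hτ]
    clamp := fun τ => ⟨κ T τ, κ_mem hT.le τ, by simp only [κ_eq (κ_mem hT.le τ)], by
      simp only [κ_eq (κ_mem hT.le τ)]⟩ }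

end Cplx
end KatoBw


namespace KatoBw

section Bsol
variable {X : Type*} [NormedAddCommGroup X] [InnerProductSpace ℂ X]
variable {A : ℝ → X →ₗ[ℂ] X} {D : Submodule ℂ X}

/-- Backward solutions with the common domain. -/
abbrev BSol (A : ℝ → X →ₗ[ℂ] X) (D : Submodule ℂ X) (t : ℝ) (x : X) (u : ℝ → X) : Prop :=
  NBCS.IsBackwardSolution A (fun _ => D) t x u

lemma rev_mem {t s : ℝ} (h : s ∈ Icc 0 t) : t - s ∈ Icc 0 t :=
  ⟨by linarith [h.2], by linarith [h.1]⟩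

lemma rev_deriv {t : ℝ} {u : ℝ → X} {a : X} {s : ℝ}
    (h : HasDerivWithinAt u a (Icc 0 t) (t - s)) :
    HasDerivWithinAt (fun σ => u (t - σ)) (-a) (Icc 0 t) s := by
  have h2 : HasDerivWithinAt (fun σ : ℝ => t - σ) (-1) (Icc 0 t) s :=
    (hasDerivWithinAt_id s _).const_sub t
  have h3 := h.scomp s h2 (fun σ hσ => rev_mem hσ)
  simp only [neg_smul, one_smul] at h3
  exact h3

lemma exists_bsol [CompleteSpace X] (hA : Hyp A D) {t : ℝ} (ht : 0 ≤ t) {x : X} (hx : x ∈ D) :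
    ∃ u, BSol A D t x u := by
  rcases eq_or_lt_of_le ht with rfl | ht
  · have hs : (Icc (0:ℝ) 0).Subsingleton := by simp
    exact ⟨fun _ => x, rfl, fun _ _ => hx,
      fun s _ => hasDerivWithinAt_iff_hasFDerivWithinAt.2 (HasFDerivWithinAt.of_subsingleton hs),
      hs.continuousOn _⟩
  · obtain ⟨u, hc, h0, hD, hd⟩ :
      ∃ u : ℝ → X, Continuous (fun τ => A (t - κ t τ) (u τ)) ∧ u 0 = x ∧ (∀ τ, u τ ∈ D) ∧
        ∀ τ ∈ Icc 0 t, HasDerivWithinAt u (A (t - κ t τ) (u τ)) (Icc 0 t) τ := by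
      letI : InnerProductSpace ℝ X := InnerProductSpace.complexToReal
      exact (mkB hA ht).exists_u x hx
    refine ⟨fun s => u (t - s), by simpa using h0, fun s _ => hD _, fun s hs => ?_, ?_⟩
    · have h1 := rev_deriv (hd (t - s) (rev_mem hs))
      rwa [κ_eq (rev_mem hs), sub_sub_cancel] at h1
    · have h1 : Continuous fun s => A (t - κ t (t - s)) (u (t - s)) :=
        hc.comp (continuous_const.sub continuous_id)
      refine h1.continuousOn.congr fun s hs => ?_
      simp only [κ_eq (rev_mem hs), sub_sub_cancel]

lemma bsol_add {t : ℝ} {x y : X} {u v : ℝ → X} (hu : BSol A D t x u) (hv : BSol A D t y v) :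
    BSol A D t (x + y) (fun s => u s + v s) := by
  refine ⟨by simp only [hu.1, hv.1], fun s hs => D.add_mem (hu.2.1 s hs) (hv.2.1 s hs),
    fun s hs => ?_, ?_⟩
  · have := (hu.2.2.1 s hs).add (hv.2.2.1 s hs)
    rw [map_add, neg_add]
    exact this
  · simp only [map_add]
    exact hu.2.2.2.add hv.2.2.2

lemma bsol_smul {t : ℝ} {x : X} {u : ℝ → X} (c : ℂ) (hu : BSol A D t x u) :
    BSol A D t (c • x) (fun s => c • u s) := by
  refine ⟨by simp only [hu.1], fun s hs => D.smul_mem c (hu.2.1 s hs), fun s hs => ?_, ?_⟩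
  · have := (hu.2.2.1 s hs).const_smul c
    rw [map_smul, ← smul_neg]
    exact this
  · simp only [map_smul]
    exact hu.2.2.2.const_smul c

lemma bsol_near (hA : Hyp A D) {t : ℝ} {x z : X} {u : ℝ → X} (hu : BSol A D t x u)
    (hz : z ∈ D) {M : ℝ} (hM : ∀ r ∈ Icc 0 t, ‖A r z‖ ≤ M) {s : ℝ} (hs : s ∈ Icc 0 t) :
    ‖u s - z‖ ≤ ‖x - z‖ + M * (t - s) := by
  have h := energy_c (T := t) (e := fun τ => u (t - τ) - z)
    (e' := fun τ => A (t - τ) (u (t - τ))) (φ := fun _ => M) continuous_const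
    (fun τ hτ => by
      have := rev_deriv (hu.2.2.1 (t - τ) (rev_mem hτ))
      rw [neg_neg] at this
      exact this.sub_const z)
    (fun τ hτ => (norm_nonneg _).trans (hM τ hτ))
    (fun τ hτ => by
      have h0 := rev_mem hτ
      have e : A (t - τ) (u (t - τ)) = A (t - τ) (u (t - τ) - z) + A (t - τ) z := by
        rw [← map_add, sub_add_cancel]
      have h1 := hA.diss (t - τ) h0.1 _ (D.sub_mem (hu.2.1 _ h0) hz)
      have h2 : (inner ℂ (u (t - τ) - z) (A (t - τ) z)).re ≤ ‖u (t - τ) - z‖ * ‖A (t - τ) z‖ :=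
        re_inner_le_norm (𝕜 := ℂ) _ _
      have h3 := mul_le_mul_of_nonneg_left (hM _ h0) (norm_nonneg (u (t - τ) - z))
      rw [e, inner_add_right, Complex.add_re]
      linarith)
    (t - s) (rev_mem hs)
  simpa [hu.1, mul_comm] using h

lemma bsol_bound (hA : Hyp A D) {t : ℝ} {x : X} {u : ℝ → X} (hu : BSol A D t x u)
    {s : ℝ} (hs : s ∈ Icc 0 t) : ‖u s‖ ≤ ‖x‖ := by
  simpa using bsol_near hA hu D.zero_mem (M := 0) (by simp) hs

lemma bsol_uniq (hA : Hyp A D) {t : ℝ} {x : X} {u v : ℝ → X} (hu : BSol A D t x u)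
    (hv : BSol A D t x v) {s : ℝ} (hs : s ∈ Icc 0 t) : u s = v s := by
  have h := bsol_bound hA (bsol_add hu (bsol_smul (-1) hv)) hs
  simp only [neg_smul, one_smul, add_neg_cancel, norm_zero] at h
  have h2 := norm_le_zero_iff.1 h
  rwa [← sub_eq_add_neg, sub_eq_zero] at h2

lemma bsol_restrict {t r : ℝ} {x : X} {u : ℝ → X} (hu : BSol A D t x u) (hr : r ≤ t) :
    BSol A D r (u r) u :=
  have hsub : Icc 0 r ⊆ Icc 0 t := Icc_subset_Icc_right hr
  ⟨rfl, fun s hs => hu.2.1 s (hsub hs), fun s hs => (hu.2.2.1 s (hsub hs)).mono hsub,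
    hu.2.2.2.mono hsub⟩

lemma exists_V [CompleteSpace X] (hA : Hyp A D) (t s : ℝ) : ∃ V : X →L[ℂ] X,
    0 ≤ s → s ≤ t → (∀ x, ‖V x‖ ≤ ‖x‖) ∧ ∀ x ∈ D, ∀ u, BSol A D t x u → u s = V x := by
  by_cases h : 0 ≤ s ∧ s ≤ t
  swap
  · exact ⟨0, fun h1 h2 => absurd ⟨h1, h2⟩ h⟩
  have hs : s ∈ Icc 0 t := h
  choose u hu using fun x : D => exists_bsol hA (h.1.trans h.2) x.2
  let F : D →ₗ[ℂ] X :=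
    { toFun := fun x => u x s
      map_add' := fun x y => bsol_uniq hA (hu (x + y)) (bsol_add (hu x) (hu y)) hs
      map_smul' := fun c x => bsol_uniq hA (hu (c • x)) (bsol_smul c (hu x)) hs }
  have hdr : DenseRange D.subtype := by
    have := hA.dense
    rw [DenseRange]
    convert this
    simp
  have hn : ∀ x : D, ‖F x‖ ≤ 1 * ‖D.subtype x‖ := fun x => by
    rw [one_mul]; exact bsol_bound hA (hu x) hs
  refine ⟨F.extendOfNorm D.subtype, fun _ _ => ⟨fun x => ?_, fun x hx v hv => ?_⟩⟩
  · simpa using LinearMap.norm_extendOfNorm_apply_le hdr 1 hn x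
  · have := LinearMap.extendOfNorm_eq hdr ⟨1, hn⟩ ⟨x, hx⟩
    simp only [Submodule.subtype_apply] at this
    rw [this]
    exact bsol_uniq hA hv (hu ⟨x, hx⟩) hs

theorem main [CompleteSpace X] (hA : Hyp A D) :
    ∃ V : ℝ → ℝ → X →L[ℂ] X, NBCS.GeneratesBackward A (fun _ => D) V (fun _ => D) := by
  choose V hV using exists_V hA
  have hVb : ∀ {t s : ℝ}, 0 ≤ s → s ≤ t → ∀ x, ‖V t s x‖ ≤ ‖x‖ := fun h1 h2 => (hV _ _ h1 h2).1
  have hVs : ∀ {t s : ℝ}, 0 ≤ s → s ≤ t → ∀ {x}, x ∈ D → ∀ {u}, BSol A D t x u → u s = V t s x :=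
    fun h1 h2 x hx u hu => (hV _ _ h1 h2).2 x hx u hu
  have hsol : ∀ {t : ℝ}, 0 ≤ t → ∀ {x}, x ∈ D → BSol A D t x (fun s => V t s x) := by
    intro t ht x hx
    obtain ⟨u, hu⟩ := exists_bsol hA ht hx
    have he : ∀ s ∈ Icc 0 t, V t s x = u s := fun s hs => (hVs hs.1 hs.2 hx hu).symm
    refine ⟨(he t ⟨ht, le_rfl⟩).trans hu.1, fun s hs => by beta_reduce; rw [he s hs]; exact hu.2.1 s hs,
      fun s hs => ?_, ?_⟩
    · beta_reduce
      rw [he s hs]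
      exact (hu.2.2.1 s hs).congr he (he s hs)
    · refine hu.2.2.2.congr fun s hs => ?_
      simp only [he s hs]
  have hVD : ∀ {t s : ℝ}, 0 ≤ s → s ≤ t → ∀ {x}, x ∈ D → V t s x ∈ D := fun h1 h2 _ hx =>
    (hsol (h1.trans h2) hx).2.1 _ ⟨h1, h2⟩
  have hone : ∀ {t : ℝ}, 0 ≤ t → ∀ {x}, x ∈ D → V t t x = x := fun ht _ hx => (hsol ht hx).1
  have hco : ∀ {s r t : ℝ}, 0 ≤ s → s ≤ r → r ≤ t → ∀ {x}, x ∈ D →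
      V t s x = V r s (V t r x) := by
    intro s r t h1 h2 h3 x hx
    exact hVs h1 h2 (hVD (h1.trans h2) h3 hx) (bsol_restrict (hsol ((h1.trans h2).trans h3) hx) h3)
  have hext : ∀ {M N : X →L[ℂ] X}, (∀ x ∈ D, M x = N x) → M = N := by
    intro M N h
    ext x
    exact congrFun (Continuous.ext_on hA.dense M.continuous N.continuous h) x
  have hcD : ∀ x ∈ D, ContinuousOn (fun p : ℝ × ℝ => V p.1 p.2 x)
      {p : ℝ × ℝ | 0 ≤ p.2 ∧ p.2 ≤ p.1} := by
    rintro x hx ⟨t0, s0⟩ ⟨hs0, hst0⟩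
    simp only at hs0 hst0
    have ht0 : 0 ≤ t0 := hs0.trans hst0
    obtain ⟨M, hM⟩ := isCompact_Icc.exists_bound_of_continuousOn (s := Icc 0 (t0 + 1))
      ((hA.c1 x hx).continuousOn.mono (fun r hr => hr.1))
    have hnear : ∀ {t s : ℝ}, 0 ≤ s → s ≤ t → t ≤ t0 + 1 → ‖V t s x - x‖ ≤ M * (t - s) := by
      intro t s h1 h2 h3
      have := bsol_near hA (hsol (h1.trans h2) hx) hx
        (fun r hr => hM r ⟨hr.1, hr.2.trans h3⟩) ⟨h1, h2⟩
      simpa using this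
    have hM0 : 0 ≤ M := (norm_nonneg _).trans (hM 0 ⟨le_rfl, by linarith⟩)
    have hkey : ∀ {t s : ℝ}, 0 ≤ s → s ≤ t → t ≤ t0 + 1 →
        ‖V t s x - V t0 (min s t0) x‖ ≤ M * |t - t0| := by
      intro t s h1 h2 h3
      rcases le_total s t0 with h | h
      · rw [min_eq_left h]
        rcases le_total t t0 with h' | h'
        · rw [hco h1 h2 h' hx, ← map_sub, abs_of_nonpos (by linarith), neg_sub]
          refine (hVb h1 h2 _).trans ?_
          rw [norm_sub_rev]
          exact hnear (h1.trans h2) h' (by linarith)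
        · rw [hco h1 h h' hx, ← map_sub, abs_of_nonneg (by linarith)]
          exact (hVb h1 h _).trans (hnear ht0 h' h3)
      · rw [min_eq_right h, hone ht0 hx, abs_of_nonneg (by linarith)]
        exact (hnear h1 h2 h3).trans (mul_le_mul_of_nonneg_left (by linarith) hM0)
    have hlim : Tendsto (fun p : ℝ × ℝ => V t0 (min p.2 t0) x)
        (nhdsWithin (t0, s0) {p : ℝ × ℝ | 0 ≤ p.2 ∧ p.2 ≤ p.1}) (nhds (V t0 s0 x)) := by
      have h1 : ContinuousWithinAt (fun s => V t0 s x) (Icc 0 t0) s0 :=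
        ((hsol ht0 hx).2.2.1 s0 ⟨hs0, hst0⟩).continuousWithinAt
      refine Tendsto.comp h1 ?_
      refine tendsto_nhdsWithin_iff.2 ⟨?_, ?_⟩
      · have : Continuous fun p : ℝ × ℝ => min p.2 t0 := by fun_prop
        have h2 := this.tendsto (t0, s0)
        simp only [min_eq_left hst0] at h2
        exact h2.mono_left nhdsWithin_le_nhds
      · filter_upwards [self_mem_nhdsWithin] with p hp
        exact ⟨le_min hp.1 ht0, min_le_right _ _⟩
    have hz : Tendsto (fun p : ℝ × ℝ => V p.1 p.2 x - V t0 (min p.2 t0) x)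
        (nhdsWithin (t0, s0) {p : ℝ × ℝ | 0 ≤ p.2 ∧ p.2 ≤ p.1}) (nhds 0) := by
      have h1 : Tendsto (fun p : ℝ × ℝ => M * |p.1 - t0|)
          (nhdsWithin (t0, s0) {p : ℝ × ℝ | 0 ≤ p.2 ∧ p.2 ≤ p.1}) (nhds 0) := by
        have : Continuous fun p : ℝ × ℝ => M * |p.1 - t0| := by fun_prop
        have h2 := this.tendsto (t0, s0)
        simp only [sub_self, abs_zero, mul_zero] at h2
        exact h2.mono_left nhdsWithin_le_nhds
      refine squeeze_zero_norm' ?_ h1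
      have h3 : ∀ᶠ p : ℝ × ℝ in nhdsWithin (t0, s0) {p : ℝ × ℝ | 0 ≤ p.2 ∧ p.2 ≤ p.1},
          p.1 < t0 + 1 :=
        nhdsWithin_le_nhds ((isOpen_lt continuous_fst continuous_const).mem_nhds (by simp))
      filter_upwards [self_mem_nhdsWithin, h3] with p hp hp3
      exact hkey hp.1 hp.2 hp3.le
    have := hz.add hlim
    simpa [ContinuousWithinAt] using this
  refine ⟨V, ⟨fun t ht => hext fun x hx => hone ht hx,
    fun s r t h1 h2 h3 => hext fun x hx => hco h1 h2 h3 hx, fun x => ?_⟩,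
    fun _ _ => hA.dense, fun _ _ => le_rfl, fun s t h1 h2 x hx => hVD h1 h2 hx,
    fun t ht x hx => hsol ht hx, fun t ht x hx u hu s hs => hVs hs.1 hs.2 hx hu⟩
  refine continuousOn_of_uniform_approx_of_continuousOn fun U hU => ?_
  obtain ⟨ε, hε, hεU⟩ := Metric.mem_uniformity_dist.1 hU
  obtain ⟨y, hy, hxy⟩ := hA.dense.exists_dist_lt x hε
  refine ⟨_, hcD y hy, fun p hp => hεU ?_⟩
  rw [dist_eq_norm, ← map_sub]
  refine (hVb hp.1 hp.2 _).trans_lt ?_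
  rwa [← dist_eq_norm]

end Bsol
end KatoBw

/-- A family `{A(t)}` of generators of contraction `C₀`-semigroups on a
Hilbert space `X` with common domain `D` such that `A(·)` is strongly `C¹` generates a
backward evolution family on `X`. -/
theorem elementary_kato_generates_backward
    {X : Type*} [NormedAddCommGroup X] [InnerProductSpace ℂ X] [CompleteSpace X]
    (A : ℝ → X →ₗ[ℂ] X) (domA : ℝ → Submodule ℂ X) (D : Submodule ℂ X)
    (hA : NBCS.ElementaryKatoClass A domA)
    (hdom : ∀ t, (0:ℝ) ≤ t → domA t = D)
    (hC1 : ∀ x ∈ D, ContDiffOn ℝ 1 (fun t => A t x) (Set.Ici (0:ℝ))) :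
    ∃ (V : ℝ → ℝ → X →L[ℂ] X) (Yreg : ℝ → Submodule ℂ X),
      NBCS.GeneratesBackward A domA V Yreg := by
  have hg : ∀ t, 0 ≤ t → NBCS.GeneratesContractionSemigroup (A t) D := fun t ht => by
    have := hA t ht
    rwa [hdom t ht] at this
  have hH : KatoBw.Hyp A D :=
    { diss := fun t ht x hx => KatoBw.gen_diss (hg t ht) hx
      surj := fun t ht k hk y => KatoBw.gen_range (hg t ht) hk y
      dense := KatoBw.gen_dense (hg 0 le_rfl)
      c1 := hC1 }
  obtain ⟨V, h1, h2, h3, h4, h5, h6⟩ := KatoBw.main hH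
  refine ⟨V, fun _ => D, h1, h2, fun t ht => (hdom t ht).ge, h4, fun t ht x hx => ?_,
    fun t ht x hx u hu => ?_⟩
  · obtain ⟨a, b, c, d⟩ := h5 t ht x hx
    exact ⟨a, fun s hs => by rw [hdom s hs.1]; exact b s hs, c, d⟩
  · obtain ⟨a, b, c, d⟩ := hu
    exact h6 t ht x hx u ⟨a, fun s hs => by rw [← hdom s hs.1]; exact b s hs, c, d⟩
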